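/- arXiv:2404.06840 — 3 statements merged into one kernel-verified Lean document; each statement's English description precedes it below -/
import Mathlib

section
/- If ρ : A → B is a nuclear linear map between C*-algebras and D is a nuclear C*-algebra, then id_D ⊗ ρ extends canonically to a bounded linear map D ⊗ A → D ⊗ B (minimal tensor products) which is again nuclear. -/
/-!
Statement 11 (Lemma 5.2(3)): if `ρ : A → B` is a nuclear linear map between
C*-algebras and `D` is a nuclear C*-algebra, then `id_D ⊗ ρ` extends canonically
to a bounded linear map `D ⊗ A → D ⊗ B` (minimal tensor products) which is again
nuclear.

Nuclearity of a linear map is encoded by quantifying over all C*-(semi)norms on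
algebraic tensor products: the minimal C*-norm is the least C*-norm and the
maximal C*-norm is the greatest C*-seminorm.
-/

noncomputable section
open scoped TensorProduct

/-- The canonical star operation on an algebraic tensor product of C*-algebras:
an additive map `s` with `s (a ⊗ d) = a* ⊗ d*`.  (Such a map exists and is unique.) -/
def IsTensorStar {A D : Type} [NonUnitalCStarAlgebra A] [NonUnitalCStarAlgebra D]
    (s : TensorProduct ℂ A D →+ TensorProduct ℂ A D) : Prop :=
  ∀ (a : A) (d : D), s (a ⊗ₜ[ℂ] d) = star a ⊗ₜ[ℂ] star d

/-- The star operation on an iterated algebraic tensor product `T ⊗ E`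
relative to a star operation `s₂` on `T`. -/
def IsTensorStarRel {T E : Type} [AddCommMonoid T] [Module ℂ T] [NonUnitalCStarAlgebra E]
    (s₂ : T →+ T) (s₃ : TensorProduct ℂ T E →+ TensorProduct ℂ T E) : Prop :=
  ∀ (x : T) (e : E), s₃ (x ⊗ₜ[ℂ] e) = s₂ x ⊗ₜ[ℂ] star e

/-- `γ` is a C*-seminorm on the (non-unital) *-algebra `T`, with star operation `s`. -/
structure IsCStarSeminorm {T : Type} [NonUnitalSemiring T] [Module ℂ T]
    (s : T →+ T) (γ : T → ℝ) : Prop where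
  nonneg : ∀ x, 0 ≤ γ x
  add_le : ∀ x y, γ (x + y) ≤ γ x + γ y
  smul : ∀ (c : ℂ) (x), γ (c • x) = ‖c‖ * γ x
  mul_le : ∀ x y, γ (x * y) ≤ γ x * γ y
  cstar : ∀ x, γ (s x * x) = γ x ^ 2

/-- `γ` is a C*-norm on the (non-unital) *-algebra `T`, with star operation `s`. -/
structure IsCStarNorm {T : Type} [NonUnitalSemiring T] [Module ℂ T]
    (s : T →+ T) (γ : T → ℝ) extends IsCStarSeminorm s γ : Prop where
  definite : ∀ x, γ x = 0 → x = 0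

/-- `ρ ⊗ id_D : A ⊗_alg D → B ⊗_max D` is bounded by `K` for every C*-algebra `D`,
where `A ⊗_alg D` carries the minimal C*-norm.  This is encoded by quantifying over
all C*-norms `γ` on `A ⊗_alg D` (the minimal norm is the least such) and all
C*-seminorms `δ` on `B ⊗_alg D` (the maximal norm is the greatest such). -/
def NuclearBound {A B : Type} [NonUnitalCStarAlgebra A] [NonUnitalCStarAlgebra B]
    (ρ : A →ₗ[ℂ] B) (K : ℝ) : Prop :=
  ∀ (D : Type) [NonUnitalCStarAlgebra D],
    ∀ (sA : TensorProduct ℂ A D →+ TensorProduct ℂ A D)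
      (sB : TensorProduct ℂ B D →+ TensorProduct ℂ B D)
      (γ : TensorProduct ℂ A D → ℝ) (δ : TensorProduct ℂ B D → ℝ),
      IsTensorStar sA → IsTensorStar sB → IsCStarNorm sA γ → IsCStarSeminorm sB δ →
      ∀ x, δ (TensorProduct.map ρ (LinearMap.id : D →ₗ[ℂ] D) x) ≤ K * γ x

/-- A linear map `ρ : A → B` between C*-algebras is nuclear if
`ρ ⊗ id : A ⊗_min D → B ⊗_max D` is bounded by some `K ≥ 0`, for all `D`. -/
def IsNuclearMap {A B : Type} [NonUnitalCStarAlgebra A] [NonUnitalCStarAlgebra B]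
    (ρ : A →ₗ[ℂ] B) : Prop :=
  ∃ K : ℝ, 0 ≤ K ∧ NuclearBound ρ K

/-- The nuclear norm `‖ρ‖_nuc` of a linear map between C*-algebras. -/
def nucNorm {A B : Type} [NonUnitalCStarAlgebra A] [NonUnitalCStarAlgebra B]
    (ρ : A →ₗ[ℂ] B) : ℝ :=
  sInf {K : ℝ | 0 ≤ K ∧ NuclearBound ρ K}

/-- `j : B → E` realizes `B` as a closed two-sided ideal of `E`. -/
structure IsIdealEmbedding {B E : Type} [NonUnitalCStarAlgebra B] [NonUnitalCStarAlgebra E]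
    (j : B →⋆ₙₐ[ℂ] E) : Prop where
  inj : Function.Injective j
  closed : IsClosed (Set.range j)
  mul_mem_left : ∀ (e : E) (b : B), ∃ b', j b' = e * j b
  mul_mem_right : ∀ (e : E) (b : B), ∃ b', j b' = j b * e

/-- A C*-algebra `D` is nuclear if for every C*-algebra `E` the C*-norm on
`D ⊗_alg E` is unique (minimal = maximal). -/
def IsNuclearCStarAlgebra (D : Type) [NonUnitalCStarAlgebra D] : Prop :=
  ∀ (E : Type) [NonUnitalCStarAlgebra E],
    ∀ (s : TensorProduct ℂ D E →+ TensorProduct ℂ D E) (γ δ : TensorProduct ℂ D E → ℝ),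
      IsTensorStar s → IsCStarNorm s γ → IsCStarNorm s δ → γ = δ

noncomputable section
open scoped TensorProduct
set_option linter.unusedSectionVars false

/-- C*-seminorm on a star algebra. -/
structure CSn {T : Type} [NonUnitalRing T] [Module ℂ T] [StarRing T] (γ : T → ℝ) : Prop where
  nonneg : ∀ x, 0 ≤ γ x
  add_le : ∀ x y, γ (x + y) ≤ γ x + γ y
  smul : ∀ (c : ℂ) (x), γ (c • x) = ‖c‖ * γ x
  mul_le : ∀ x y, γ (x * y) ≤ γ x * γ y
  cstar : ∀ x, γ (star x * x) = γ x ^ 2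

namespace CSn
variable {T : Type} [NonUnitalRing T] [Module ℂ T] [IsScalarTower ℂ T T] [SMulCommClass ℂ T T]
  [StarRing T] [StarModule ℂ T] {γ : T → ℝ}

lemma map_zero (h : CSn γ) : γ 0 = 0 := by
  have := h.smul 0 0
  simpa using this

lemma map_neg (h : CSn γ) (x : T) : γ (-x) = γ x := by
  have := h.smul (-1) x
  simpa using this

lemma le_of_sq {a b : ℝ} (ha : 0 ≤ a) (hb : 0 ≤ b) (h : a ^ 2 ≤ b * a) : a ≤ b := by
  rcases ha.eq_or_lt with h0 | h0
  · rw [← h0]; exact hb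
  · rw [sq] at h; exact le_of_mul_le_mul_right h h0

lemma le_star (h : CSn γ) (x : T) : γ x ≤ γ (star x) :=
  le_of_sq (h.nonneg _) (h.nonneg _) (by rw [← h.cstar]; exact h.mul_le _ _)

lemma map_star (h : CSn γ) (x : T) : γ (star x) = γ x :=
  le_antisymm (by simpa using h.le_star (star x)) (h.le_star x)

lemma sub_le (h : CSn γ) (x y : T) : γ (x - y) ≤ γ x + γ y := by
  rw [sub_eq_add_neg, ← h.map_neg y]; exact h.add_le _ _

lemma sum_le (h : CSn γ) {ι : Type*} (s : Finset ι) (f : ι → T) :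
    γ (∑ i ∈ s, f i) ≤ ∑ i ∈ s, γ (f i) :=
  Finset.le_sum_of_subadditive γ h.map_zero.le h.add_le s f

end CSn

end

noncomputable section
open scoped TensorProduct
set_option linter.unusedSectionVars false

section compl
open UniformSpace
variable {T : Type} [NonUnitalSeminormedRing T] [NormedSpace ℂ T] [IsScalarTower ℂ T T]
  [SMulCommClass ℂ T T] [StarRing T] [StarModule ℂ T]

/-- left multiplication extended to the completion -/
def cMul0 (x : T) : Completion T →L[ℂ] Completion T := (ContinuousLinearMap.mul ℂ T x).completion

lemma cMul0_coe (x y : T) : cMul0 x (y : Completion T) = ((x * y : T) : Completion T) := by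
  simp [cMul0]

/-- left multiplication as a linear map -/
def cMul1 : T →ₗ[ℂ] Completion T →L[ℂ] Completion T where
  toFun := cMul0
  map_add' := fun x y => by
    refine ContinuousLinearMap.ext fun c => ?_
    refine Completion.induction_on c (isClosed_eq (ContinuousLinearMap.continuous _)
      (ContinuousLinearMap.continuous _)) fun c => ?_
    rw [_root_.add_apply, cMul0_coe, cMul0_coe, cMul0_coe, add_mul, Completion.coe_add]
  map_smul' := fun m x => by
    refine ContinuousLinearMap.ext fun c => ?_
    refine Completion.induction_on c (isClosed_eq (ContinuousLinearMap.continuous _)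
      (ContinuousLinearMap.continuous _)) fun c => ?_
    rw [RingHom.id_apply, _root_.smul_apply, cMul0_coe, cMul0_coe, smul_mul_assoc,
      Completion.coe_smul]

lemma cMul0_norm (x : T) (c : Completion T) : ‖cMul0 x c‖ ≤ ‖x‖ * ‖c‖ := by
  refine Completion.induction_on c (isClosed_le (by fun_prop) (by fun_prop)) fun c => ?_
  rw [cMul0_coe, Completion.norm_coe, Completion.norm_coe]
  exact norm_mul_le _ _

lemma cMul1_norm (x : T) : ‖cMul1 x‖ ≤ 1 * ‖x‖ := by
  rw [one_mul]
  refine ContinuousLinearMap.opNorm_le_bound (cMul1 x) (norm_nonneg x) fun c => ?_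
  exact cMul0_norm x c

/-- left multiplication, continuous -/
def cMul2 : T →L[ℂ] Completion T →L[ℂ] Completion T :=
  { toLinearMap := cMul1, cont := AddMonoidHomClass.continuous_of_bound (cMul1 (T := T)) 1 cMul1_norm }

lemma cMul2_apply (x : T) : cMul2 x = cMul0 x := rfl

/-- left multiplication, extended -/
def cMulL : Completion T →L[ℂ] Completion T →L[ℂ] Completion T :=
  cMul2.extend (Completion.toComplL : T →L[ℂ] Completion T)

lemma cMulL_coe (x y : T) :
    cMulL (x : Completion T) (y : Completion T) = ((x * y : T) : Completion T) := by
  have := ContinuousLinearMap.extend_eq (cMul2 (T := T))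
    (e := (Completion.toComplL : T →L[ℂ] Completion T)) Completion.denseRange_coe
    (Completion.isUniformInducing_coe T) x
  have h2 := DFunLike.congr_fun this (y : Completion T)
  rw [cMul2_apply, cMul0_coe] at h2
  exact h2


/-- the completion of a pre-C*-algebra -/
def Cpl (T : Type) [NonUnitalSeminormedRing T] : Type := Completion T

instance : NormedAddCommGroup (Cpl T) := inferInstanceAs (NormedAddCommGroup (Completion T))
instance : NormedSpace ℂ (Cpl T) := inferInstanceAs (NormedSpace ℂ (Completion T))
instance : CompleteSpace (Cpl T) := inferInstanceAs (CompleteSpace (Completion T))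

/-- the inclusion -/
def Cpl.mk (x : T) : Cpl T := (x : Completion T)

lemma Cpl.dense : DenseRange (Cpl.mk : T → Cpl T) := Completion.denseRange_coe
lemma Cpl.norm_mk (x : T) : ‖Cpl.mk x‖ = ‖x‖ := Completion.norm_coe x
lemma Cpl.mk_add (x y : T) : Cpl.mk (x + y) = Cpl.mk x + Cpl.mk y := Completion.coe_add x y
lemma Cpl.mk_smul (c : ℂ) (x : T) : Cpl.mk (c • x) = c • Cpl.mk x := Completion.coe_smul c x
lemma Cpl.mk_zero : Cpl.mk (0 : T) = 0 := Completion.coe_zero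
lemma Cpl.continuous_mk : Continuous (Cpl.mk : T → Cpl T) := Completion.continuous_coe T

/-- the product -/
def Cpl.m : Cpl T →L[ℂ] Cpl T →L[ℂ] Cpl T := cMulL

instance : Mul (Cpl T) := ⟨fun x y => Cpl.m x y⟩

lemma Cpl.mul_def (x y : Cpl T) : x * y = Cpl.m x y := rfl
lemma Cpl.mk_mul (x y : T) : Cpl.mk (x * y) = Cpl.mk x * Cpl.mk y := (cMulL_coe x y).symm

instance : ContinuousMul (Cpl T) := ⟨by
  have : (fun p : Cpl T × Cpl T => p.1 * p.2) = fun p => Cpl.m p.1 p.2 := rfl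
  rw [this]; fun_prop⟩

lemma Cpl.ind {p : Cpl T → Prop} (hc : IsClosed {x | p x}) (h : ∀ x : T, p (Cpl.mk x)) (x) : p x :=
  Completion.induction_on x hc h

instance : NonUnitalRing (Cpl T) where
  left_distrib x y z := by simp only [Cpl.mul_def, _root_.map_add]
  right_distrib x y z := by simp only [Cpl.mul_def, _root_.map_add, _root_.add_apply]
  zero_mul x := by simp only [Cpl.mul_def, _root_.map_zero, _root_.zero_apply]
  mul_zero x := by simp only [Cpl.mul_def, _root_.map_zero]
  mul_assoc x y z := by
    refine Cpl.ind (p := fun x => x * y * z = x * (y * z)) (isClosed_eq (by fun_prop) (by fun_prop)) (fun x => ?_) x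
    refine Cpl.ind (p := fun y => Cpl.mk x * y * z = Cpl.mk x * (y * z)) (isClosed_eq (by fun_prop) (by fun_prop)) (fun y => ?_) y
    refine Cpl.ind (p := fun z => Cpl.mk x * Cpl.mk y * z = Cpl.mk x * (Cpl.mk y * z)) (isClosed_eq (by fun_prop) (by fun_prop)) (fun z => ?_) z
    simp only [← Cpl.mk_mul, mul_assoc]

instance : NonUnitalNormedRing (Cpl T) where
  dist_eq := dist_eq_norm_neg_add
  norm_mul_le x y := by
    refine Cpl.ind (p := fun x => ‖x * y‖ ≤ ‖x‖ * ‖y‖) (isClosed_le (by fun_prop) (by fun_prop)) (fun x => ?_) x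
    refine Cpl.ind (p := fun y => ‖Cpl.mk x * y‖ ≤ ‖Cpl.mk x‖ * ‖y‖) (isClosed_le (by fun_prop) (by fun_prop)) (fun y => ?_) y
    simp only [← Cpl.mk_mul, Cpl.norm_mk]
    exact norm_mul_le _ _

instance : IsScalarTower ℂ (Cpl T) (Cpl T) := ⟨fun c x y => by
  simp only [smul_eq_mul, Cpl.mul_def, _root_.map_smul, _root_.smul_apply]⟩
instance : SMulCommClass ℂ (Cpl T) (Cpl T) := ⟨fun c x y => by
  simp only [smul_eq_mul, Cpl.mul_def, _root_.map_smul]⟩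

/-- pre-C*-algebra -/
class PreC (T : Type) [NonUnitalSeminormedRing T] [StarRing T] : Prop where
  le : ∀ x : T, ‖x‖ * ‖x‖ ≤ ‖star x * x‖

variable [NormedStarGroup T] [PreC T]

/-- star on the completion -/
def Cpl.st (x : Cpl T) : Cpl T := Completion.map (star : T → T) x

lemma uc_star : UniformContinuous (star : T → T) :=
  (Isometry.of_dist_eq fun x y => by
    rw [dist_eq_norm, dist_eq_norm, ← star_sub, norm_star]).uniformContinuous

lemma Cpl.continuous_st : Continuous (Cpl.st : Cpl T → Cpl T) := Completion.continuous_map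
lemma Cpl.st_mk (x : T) : Cpl.st (Cpl.mk x) = Cpl.mk (star x) := Completion.map_coe uc_star x

instance : Star (Cpl T) := ⟨Cpl.st⟩
lemma Cpl.star_mk (x : T) : star (Cpl.mk x) = Cpl.mk (star x) := Cpl.st_mk x
instance : ContinuousStar (Cpl T) := ⟨Cpl.continuous_st⟩

instance : StarRing (Cpl T) where
  star_involutive x := by
    refine Cpl.ind (p := fun x => star (star x) = x) (isClosed_eq (by fun_prop) (by fun_prop)) (fun x => ?_) x
    simp only [Cpl.star_mk, star_star]
  star_mul x y := by
    refine Cpl.ind (p := fun x => star (x * y) = star y * star x) (isClosed_eq (by fun_prop) (by fun_prop)) (fun x => ?_) x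
    refine Cpl.ind (p := fun y => star (Cpl.mk x * y) = star y * star (Cpl.mk x)) (isClosed_eq (by fun_prop) (by fun_prop)) (fun y => ?_) y
    simp only [Cpl.star_mk, ← Cpl.mk_mul, star_mul]
  star_add x y := by
    refine Cpl.ind (p := fun x => star (x + y) = star x + star y) (isClosed_eq (by fun_prop) (by fun_prop)) (fun x => ?_) x
    refine Cpl.ind (p := fun y => star (Cpl.mk x + y) = star (Cpl.mk x) + star y) (isClosed_eq (by fun_prop) (by fun_prop)) (fun y => ?_) y
    simp only [Cpl.star_mk, ← Cpl.mk_add, star_add]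

instance : CStarRing (Cpl T) := ⟨fun x => by
  refine Cpl.ind (p := fun x => ‖x‖ * ‖x‖ ≤ ‖star x * x‖) (isClosed_le (by fun_prop) (by fun_prop)) (fun x => ?_) x
  simp only [Cpl.star_mk, ← Cpl.mk_mul, Cpl.norm_mk]
  exact PreC.le x⟩

instance : StarModule ℂ (Cpl T) where
  star_smul := fun c x => by
    refine Cpl.ind (p := fun x => star (c • x) = star c • star x) (isClosed_eq
      (continuous_star.comp (continuous_const_smul c))
      (Continuous.comp (continuous_const_smul (star c)) continuous_star)) (fun x => ?_) x
    simp only [Cpl.star_mk, ← Cpl.mk_smul, star_smul]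

instance : NonUnitalCStarAlgebra (Cpl T) where

/-- inclusion as star hom -/
def Cpl.hom : T →⋆ₙₐ[ℂ] Cpl T where
  toFun := Cpl.mk
  map_smul' := Cpl.mk_smul
  map_zero' := Cpl.mk_zero
  map_add' := Cpl.mk_add
  map_mul' := Cpl.mk_mul
  map_star' x := (Cpl.star_mk x).symm

end compl

theorem CSn.exists_completion {T : Type} [NonUnitalRing T] [Module ℂ T] [IsScalarTower ℂ T T]
    [SMulCommClass ℂ T T] [StarRing T] [StarModule ℂ T] {γ : T → ℝ} (h : CSn γ) :
    ∃ (Q : Type) (_ : NonUnitalCStarAlgebra Q) (φ : T →⋆ₙₐ[ℂ] Q),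
      DenseRange φ ∧ ∀ x, ‖φ x‖ = γ x := by
  let i0 : Norm T := ⟨γ⟩
  let i1 : SeminormedAddCommGroup T := SeminormedAddCommGroup.ofCore (𝕜 := ℂ)
    ⟨h.nonneg, h.smul, h.add_le⟩
  let i2 : NonUnitalSeminormedRing T :=
    { i1, (inferInstance : NonUnitalRing T) with
      norm_mul_le := h.mul_le }
  let i3 : NormedSpace ℂ T := ⟨fun c x => (h.smul c x).le⟩
  have i4 : PreC T := ⟨fun x => by rw [← sq]; exact (h.cstar x).ge⟩
  have i5 : NormedStarGroup T := ⟨fun x => (h.map_star x).le⟩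
  exact ⟨Cpl T, inferInstance, Cpl.hom, Cpl.dense, Cpl.norm_mk⟩

end

noncomputable section
open scoped TensorProduct
set_option linter.unusedSectionVars false

/-- an adjointable action by left multipliers -/
structure IsAct {R T : Type} [NonUnitalRing R] [Module ℂ R] [StarRing R]
    [NonUnitalRing T] [Module ℂ T] [StarRing T] (M : R →ₗ[ℂ] T →ₗ[ℂ] T) : Prop where
  mul : ∀ x y w, M (x * y) w = M x (M y w)
  adj : ∀ x v w, star (M x v) * w = star v * M (star x) w

section act
variable {C T : Type} [NonUnitalRing T] [Module ℂ T] [IsScalarTower ℂ T T]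
    [SMulCommClass ℂ T T] [StarRing T] [StarModule ℂ T] {γ : T → ℝ}

lemma IsAct.bound1 [CStarAlgebra C] {M : C →ₗ[ℂ] T →ₗ[ℂ] T} (hM : IsAct M) (h1 : M 1 = LinearMap.id)
    (h : CSn γ) (a : C) (w : T) : γ (M a w) ≤ ‖a‖ * γ w := by
  obtain ⟨Q, _, φ, -, hφ⟩ := h.exists_completion
  let _ : PartialOrder C := CStarAlgebra.spectralOrder C
  have _ : StarOrderedRing C := CStarAlgebra.spectralOrderedRing C
  let _ : PartialOrder Q := CStarAlgebra.spectralOrder Q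
  have _ : StarOrderedRing Q := CStarAlgebra.spectralOrderedRing Q
  have h0 : 0 ≤ algebraMap ℝ C (‖a‖ ^ 2) - star a * a :=
    sub_nonneg.2 (CStarAlgebra.star_mul_le_algebraMap_norm_sq)
  obtain ⟨c, hc⟩ := CStarAlgebra.nonneg_iff_eq_star_mul_self.1 h0
  have h2 : star (M c w) * M c w = ((‖a‖ ^ 2 : ℝ) : ℂ) • (star w * w) - star (M a w) * M a w := by
    rw [hM.adj, hM.adj, ← hM.mul, ← hM.mul, ← hc, map_sub, LinearMap.sub_apply, mul_sub,
      Algebra.algebraMap_eq_smul_one, ← Complex.coe_smul, map_smul, h1, LinearMap.smul_apply,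
      LinearMap.id_apply, mul_smul_comm]
  have h3 : star (φ (M a w)) * φ (M a w) ≤ ((‖a‖ ^ 2 : ℝ) : ℂ) • (star (φ w) * φ w) := by
    rw [← sub_nonneg]
    have : φ (star (M c w) * M c w) = ((‖a‖ ^ 2 : ℝ) : ℂ) • (star (φ w) * φ w) - star (φ (M a w)) * φ (M a w) := by
      rw [h2, map_sub, map_smul, map_mul, map_mul, map_star, map_star]
    rw [← this, map_mul, map_star]
    exact star_mul_self_nonneg _
  have h4 := CStarAlgebra.norm_le_norm_of_nonneg_of_le (star_mul_self_nonneg _) h3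
  rw [norm_smul, CStarRing.norm_star_mul_self, CStarRing.norm_star_mul_self, hφ, hφ,
    Complex.norm_real, Real.norm_of_nonneg (by positivity)] at h4
  refine abs_le_of_sq_le_sq' ?_ (mul_nonneg (norm_nonneg _) (h.nonneg _)) |>.2
  nlinarith

/-- extension of an action to the unitization -/
def actU [NonUnitalCStarAlgebra C] (M : C →ₗ[ℂ] T →ₗ[ℂ] T) : Unitization ℂ C →ₗ[ℂ] T →ₗ[ℂ] T where
  toFun c := c.fst • LinearMap.id + M c.snd
  map_add' := fun x y => by simp only [Unitization.fst_add, Unitization.snd_add, map_add]; module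
  map_smul' := fun x y => by
    simp only [Unitization.fst_smul, Unitization.snd_smul, map_smul, RingHom.id_apply, smul_add, smul_eq_mul, mul_smul]

lemma actU_apply [NonUnitalCStarAlgebra C] (M : C →ₗ[ℂ] T →ₗ[ℂ] T) (c w) :
    actU M c w = c.fst • w + M c.snd w := rfl

lemma actU_inr [NonUnitalCStarAlgebra C] (M : C →ₗ[ℂ] T →ₗ[ℂ] T) (c : C) (w) :
    actU M (c : Unitization ℂ C) w = M c w := by simp [actU_apply]

lemma IsAct.actU [NonUnitalCStarAlgebra C] {M : C →ₗ[ℂ] T →ₗ[ℂ] T} (hM : IsAct M) :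
    IsAct (actU M) where
  mul x y w := by
    simp only [actU_apply, Unitization.fst_mul, Unitization.snd_mul, map_add, map_smul, hM.mul,
      LinearMap.add_apply, LinearMap.smul_apply]
    module
  adj x v w := by
    simp only [actU_apply, Unitization.fst_star, Unitization.snd_star, star_add, star_smul, add_mul,
      mul_add, hM.adj, smul_mul_assoc, mul_smul_comm]

lemma actU_one [NonUnitalCStarAlgebra C] (M : C →ₗ[ℂ] T →ₗ[ℂ] T) : actU M 1 = LinearMap.id := by
  ext w; simp [actU_apply]

lemma IsAct.boundU [NonUnitalCStarAlgebra C] {M : C →ₗ[ℂ] T →ₗ[ℂ] T} (hM : IsAct M)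
    (h : CSn γ) (a : Unitization ℂ C) (w : T) : γ (_root_.actU M a w) ≤ ‖a‖ * γ w :=
  hM.actU.bound1 (actU_one M) h a w

lemma IsAct.bound [NonUnitalCStarAlgebra C] {M : C →ₗ[ℂ] T →ₗ[ℂ] T} (hM : IsAct M)
    (h : CSn γ) (a : C) (w : T) : γ (M a w) ≤ ‖a‖ * γ w := by
  have := hM.boundU h (a : Unitization ℂ C) w
  rwa [actU_inr, Unitization.norm_inr] at this

end act

section induced
variable {R T : Type} [NonUnitalRing R] [Module ℂ R] [IsScalarTower ℂ R R]
    [SMulCommClass ℂ R R] [StarRing R] [StarModule ℂ R] [NonUnitalRing T] [Module ℂ T] [IsScalarTower ℂ T T]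
    [SMulCommClass ℂ T T] [StarRing T] [StarModule ℂ T] {γ : T → ℝ}

/-- the seminorm induced on `R` by an action and a subset -/
def qW (γ : T → ℝ) (M : R →ₗ[ℂ] T →ₗ[ℂ] T) (W : Set T) (y : R) : ℝ :=
  sInf {c : ℝ | 0 ≤ c ∧ ∀ w ∈ W, γ (M y w) ≤ c * γ w}

variable {M : R →ₗ[ℂ] T →ₗ[ℂ] T} {W : Set T}

lemma qW_nonneg (y : R) : 0 ≤ qW γ M W y := Real.sInf_nonneg fun _ h => h.1

lemma qW_le {y : R} {c : ℝ} (hc : 0 ≤ c) (h : ∀ w ∈ W, γ (M y w) ≤ c * γ w) : qW γ M W y ≤ c :=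
  csInf_le ⟨0, fun _ h => h.1⟩ ⟨hc, h⟩

lemma le_qW (h : CSn γ) (hb : ∀ y, ∃ c : ℝ, 0 ≤ c ∧ ∀ w ∈ W, γ (M y w) ≤ c * γ w) (y : R) {w : T} (hw : w ∈ W) :
    γ (M y w) ≤ qW γ M W y * γ w := by
  rcases (h.nonneg w).eq_or_lt with h0 | h0
  · obtain ⟨c, hc, h1⟩ := hb y
    have := h1 w hw
    rw [← h0] at this ⊢
    simpa using this
  · rw [← div_le_iff₀ h0]
    exact le_csInf (hb y) fun c hc => (div_le_iff₀ h0).2 (hc.2 w hw)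

lemma qW_csn (h : CSn γ) (hM : IsAct M) (hW : ∀ y, ∀ w ∈ W, M y w ∈ W)
    (hb : ∀ y, ∃ c : ℝ, 0 ≤ c ∧ ∀ w ∈ W, γ (M y w) ≤ c * γ w) : CSn (qW γ M W) := by
  have hmul : ∀ x y, qW γ M W (x * y) ≤ qW γ M W x * qW γ M W y := fun x y => by
    refine qW_le (mul_nonneg (qW_nonneg _) (qW_nonneg _)) fun w hw => ?_
    rw [hM.mul, mul_assoc]
    exact (le_qW h hb x (hW y w hw)).trans (mul_le_mul_of_nonneg_left (le_qW h hb y hw) (qW_nonneg _))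
  have hsm : ∀ (c : ℂ) (x), qW γ M W (c • x) ≤ ‖c‖ * qW γ M W x := fun c x => by
    refine qW_le (mul_nonneg (norm_nonneg _) (qW_nonneg _)) fun w hw => ?_
    rw [map_smul, LinearMap.smul_apply, h.smul, mul_assoc]
    exact mul_le_mul_of_nonneg_left (le_qW h hb x hw) (norm_nonneg _)
  have hsq : ∀ x, qW γ M W x ^ 2 ≤ qW γ M W (star x * x) := fun x => by
    have : qW γ M W x ≤ √ (qW γ M W (star x * x)) := by
      refine qW_le (Real.sqrt_nonneg _) fun w hw => ?_
      have h1 : γ (M x w) ^ 2 ≤ qW γ M W (star x * x) * γ w ^ 2 := by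
        rw [← h.cstar, hM.adj, ← hM.mul]
        refine (h.mul_le _ _).trans ?_
        rw [h.map_star]
        nlinarith [mul_le_mul_of_nonneg_left (le_qW h hb (star x * x) hw) (h.nonneg w)]
      refine abs_le_of_sq_le_sq' ?_ (mul_nonneg (Real.sqrt_nonneg _) (h.nonneg _)) |>.2
      rw [mul_pow, Real.sq_sqrt (qW_nonneg _)]
      exact h1
    calc _ ≤ √ (qW γ M W (star x * x)) ^ 2 := pow_le_pow_left₀ (qW_nonneg _) this 2
      _ = _ := Real.sq_sqrt (qW_nonneg _)
  have hle : ∀ x, qW γ M W x ≤ qW γ M W (star x) := fun x =>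
    CSn.le_of_sq (qW_nonneg _) (qW_nonneg _) ((hsq x).trans (hmul _ _))
  refine ⟨fun x => qW_nonneg x, fun x y => ?_, fun c x => le_antisymm (hsm c x) ?_, hmul, fun x => le_antisymm ?_ (hsq x)⟩
  · refine qW_le (add_nonneg (qW_nonneg _) (qW_nonneg _)) fun w hw => ?_
    rw [map_add, LinearMap.add_apply, add_mul]
    exact (h.add_le _ _).trans (add_le_add (le_qW h hb x hw) (le_qW h hb y hw))
  · rcases eq_or_ne c 0 with rfl | hc
    · simpa using qW_nonneg _
    · have := hsm c⁻¹ (c • x)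
      rw [smul_smul, inv_mul_cancel₀ hc, one_smul, norm_inv] at this
      rwa [← le_inv_mul_iff₀ (norm_pos_iff.2 hc)]
  · refine (hmul _ _).trans ?_
    rw [sq]
    refine mul_le_mul_of_nonneg_right ?_ (qW_nonneg _)
    simpa using hle (star x)

end induced

section tens
variable {R T A D E : Type} [NonUnitalRing R] [Module ℂ R] [IsScalarTower ℂ R R]
    [SMulCommClass ℂ R R] [StarRing R] [StarModule ℂ R] [NonUnitalRing T] [Module ℂ T] [IsScalarTower ℂ T T]
    [SMulCommClass ℂ T T] [StarRing T] [StarModule ℂ T]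
    [NonUnitalRing A] [Module ℂ A] [IsScalarTower ℂ A A]
    [SMulCommClass ℂ A A] [StarRing A] [StarModule ℂ A]

lemma IsAct.mulSelf : IsAct (LinearMap.mul ℂ A) where
  mul x y w := by simp [mul_assoc]
  adj x y w := by simp [mul_assoc]

lemma IsAct.lT {M : R →ₗ[ℂ] T →ₗ[ℂ] T} (hM : IsAct M) : IsAct (LinearMap.lTensorHom A ∘ₗ M) where
  mul x y w := by
    induction w with
    | zero => simp
    | add a b ha hb => simp only [map_add, ha, hb]
    | tmul a t => simp [hM.mul]
  adj x v w := by
    induction v with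
    | zero => simp
    | add a b ha hb => simp only [map_add, ha, hb, star_add, add_mul]
    | tmul a t =>
      induction w with
      | zero => simp
      | add a b ha hb => simp only [map_add, ha, hb, mul_add]
      | tmul b s => simp [hM.adj]

lemma IsAct.rT {M : R →ₗ[ℂ] T →ₗ[ℂ] T} (hM : IsAct M) : IsAct (LinearMap.rTensorHom A ∘ₗ M) where
  mul x y w := by
    induction w with
    | zero => simp
    | add a b ha hb => simp only [map_add, ha, hb]
    | tmul a t => simp [hM.mul]
  adj x v w := by
    induction v with
    | zero => simp
    | add a b ha hb => simp only [map_add, ha, hb, star_add, add_mul]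
    | tmul a t =>
      induction w with
      | zero => simp
      | add a b ha hb => simp only [map_add, ha, hb, mul_add]
      | tmul b s => simp [hM.adj]

end tens

/-- left action of `A` on `A ⊗ R` -/
abbrev actL (A R : Type) [NonUnitalRing A] [Module ℂ A] [IsScalarTower ℂ A A] [SMulCommClass ℂ A A]
    [NonUnitalRing R] [Module ℂ R] : A →ₗ[ℂ] (A ⊗[ℂ] R) →ₗ[ℂ] (A ⊗[ℂ] R) :=
  LinearMap.rTensorHom R ∘ₗ LinearMap.mul ℂ A

/-- left action of `R` on `A ⊗ R` -/
abbrev actR (A R : Type) [NonUnitalRing A] [Module ℂ A] [NonUnitalRing R] [Module ℂ R]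
    [IsScalarTower ℂ R R] [SMulCommClass ℂ R R] : R →ₗ[ℂ] (A ⊗[ℂ] R) →ₗ[ℂ] (A ⊗[ℂ] R) :=
  LinearMap.lTensorHom A ∘ₗ LinearMap.mul ℂ R

section tens2
variable {A D E : Type} [NonUnitalCStarAlgebra A] [NonUnitalCStarAlgebra D] [NonUnitalCStarAlgebra E]
  {γ : A ⊗[ℂ] (D ⊗[ℂ] E) → ℝ}

lemma actR_bdd (h : CSn γ) (y : D ⊗[ℂ] E) :
    ∃ c : ℝ, 0 ≤ c ∧ ∀ w, γ (actR A (D ⊗[ℂ] E) y w) ≤ c * γ w := by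
  induction y with
  | zero => exact ⟨0, le_rfl, fun w => by simp [h.map_zero]⟩
  | add x y hx hy =>
    obtain ⟨c, hc, hx⟩ := hx
    obtain ⟨d, hd, hy⟩ := hy
    refine ⟨c + d, add_nonneg hc hd, fun w => ?_⟩
    rw [map_add, LinearMap.add_apply, add_mul]
    exact (h.add_le _ _).trans (add_le_add (hx w) (hy w))
  | tmul d e =>
    refine ⟨‖d‖ * ‖e‖, by positivity, fun w => ?_⟩
    have h1 : IsAct (R := D) (T := A ⊗[ℂ] (D ⊗[ℂ] E)) (LinearMap.lTensorHom A ∘ₗ actL D E) :=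
      (IsAct.mulSelf (A := D)).rT.lT
    have h2 : IsAct (R := E) (T := A ⊗[ℂ] (D ⊗[ℂ] E)) (LinearMap.lTensorHom A ∘ₗ actR D E) :=
      (IsAct.mulSelf (A := E)).lT.lT
    have : actR A (D ⊗[ℂ] E) (d ⊗ₜ e) w =
        (LinearMap.lTensorHom A ∘ₗ actL D E) d ((LinearMap.lTensorHom A ∘ₗ actR D E) e w) := by
      induction w with
      | zero => simp
      | add a b ha hb => simp only [map_add, ha, hb]
      | tmul a r =>
        induction r with
        | zero => simp
        | add a b ha hb => simp only [map_add, ha, hb, TensorProduct.tmul_add]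
        | tmul d e => simp
    rw [this, mul_assoc]
    exact (h1.bound h _ _).trans (mul_le_mul_of_nonneg_left (h2.bound h _ _) (norm_nonneg _))

end tens2
end

noncomputable section
open scoped TensorProduct
set_option linter.unusedSectionVars false

lemma CSn.ofSq {T : Type} [NonUnitalRing T] [Module ℂ T] [StarRing T] {γ : T → ℝ}
    (h1 : ∀ x, 0 ≤ γ x) (h2 : ∀ x y, γ (x + y) ≤ γ x + γ y)
    (h3 : ∀ (c : ℂ) (x), γ (c • x) = ‖c‖ * γ x) (h4 : ∀ x y, γ (x * y) ≤ γ x * γ y)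
    (h5 : ∀ x, γ x ^ 2 ≤ γ (star x * x)) : CSn γ := by
  have hle : ∀ x, γ x ≤ γ (star x) := fun x =>
    CSn.le_of_sq (h1 _) (h1 _) ((h5 x).trans (h4 _ _))
  refine ⟨h1, h2, h3, h4, fun x => le_antisymm ((h4 _ _).trans ?_) (h5 x)⟩
  rw [sq]
  refine mul_le_mul_of_nonneg_right ?_ (h1 _)
  simpa using hle (star x)

lemma CSn.iSup {T ι : Type} [NonUnitalRing T] [Module ℂ T] [StarRing T] [Nonempty ι] {γ : ι → T → ℝ}
    (h : ∀ i, CSn (γ i)) (hb : ∀ x, BddAbove (Set.range fun i => γ i x)) :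
    CSn (fun x => ⨆ i, γ i x) := by
  have h0 : ∀ x, 0 ≤ ⨆ i, γ i x := fun x => Real.iSup_nonneg fun i => (h i).nonneg x
  have hl : ∀ i x, γ i x ≤ ⨆ i, γ i x := fun i x => le_ciSup (hb x) i
  refine CSn.ofSq h0 (fun x y => ciSup_le fun i => ?_) (fun c x => ?_) (fun x y => ciSup_le fun i => ?_) (fun x => ?_)
  · exact ((h i).add_le _ _).trans (add_le_add (hl _ _) (hl _ _))
  · simp only [(h _).smul]
    exact (Real.mul_iSup_of_nonneg (norm_nonneg _) _).symm
  · exact ((h i).mul_le _ _).trans (mul_le_mul (hl _ _) (hl _ _) ((h i).nonneg _) (h0 _))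
  · have : (⨆ i, γ i x) ≤ √ (⨆ i, γ i (star x * x)) := by
      refine ciSup_le fun i => Real.le_sqrt_of_sq_le ?_
      rw [← (h i).cstar]; exact hl i _
    calc _ ≤ √ (⨆ i, γ i (star x * x)) ^ 2 := pow_le_pow_left₀ (h0 _) this 2
      _ = _ := Real.sq_sqrt (h0 _)

section rep
open scoped ComplexOrder ComplexStarModule

lemma exists_pos {A : Type} [NonUnitalCStarAlgebra A] [PartialOrder A] [StarOrderedRing A]
    {x : A} (hx : x ≠ 0) : ∃ f : A →ₚ[ℂ] ℂ, f (star x * x) ≠ 0 := by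
  have h1 : -(star x * x) ∉ ProperCone.positive ℝ A := by
    rw [ProperCone.mem_positive]
    intro h
    have h2 : star x * x = 0 := le_antisymm (neg_nonneg.1 h) (star_mul_self_nonneg x)
    exact hx (CStarRing.star_mul_self_eq_zero_iff x |>.1 h2)
  obtain ⟨f, hf, hfx⟩ := ProperCone.hyperplane_separation_point _ h1
  let F : A →ₗ[ℂ] ℂ :=
    { toFun := fun a => (f (realPart a : A) : ℂ) + Complex.I * (f (imaginaryPart a : A) : ℂ)
      map_add' := fun a b => by simp; ring
      map_smul' := fun c a => by
        rw [realPart_smul, imaginaryPart_smul]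
        apply Complex.ext <;> simp }
  have hF : ∀ a : A, IsSelfAdjoint a → F a = f a := fun a ha => by
    simp [F, ha.coe_realPart, ha.imaginaryPart]
  refine ⟨PositiveLinearMap.mk₀ F fun a ha => ?_, ?_⟩
  · rw [hF a ha.isSelfAdjoint]
    exact_mod_cast hf a ha
  · change F _ ≠ 0
    rw [hF _ (IsSelfAdjoint.star_mul_self x)]
    rw [map_neg] at hfx
    have : f (star x * x) ≠ 0 := by linarith [hfx] |> fun (h : 0 < f (star x * x)) => h.ne'
    exact_mod_cast this

lemma exists_rep {A : Type} [NonUnitalCStarAlgebra A] {x : A} (hx : x ≠ 0) :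
    ∃ (H : Type) (_ : NormedAddCommGroup H) (_ : InnerProductSpace ℂ H) (_ : CompleteSpace H)
      (π : A →⋆ₙₐ[ℂ] (H →L[ℂ] H)), π x ≠ 0 := by
  let _ : PartialOrder A := CStarAlgebra.spectralOrder A
  have _ : StarOrderedRing A := CStarAlgebra.spectralOrderedRing A
  have h2 : x * star x ≠ 0 := fun h => hx (CStarRing.mul_star_self_eq_zero_iff x |>.1 h)
  obtain ⟨f, hf⟩ := exists_pos h2
  refine ⟨f.GNS, inferInstance, inferInstance, inferInstance, f.gnsNonUnitalStarAlgHom, fun h => hf ?_⟩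
  have h3 := f.gnsNonUnitalStarAlgHom_apply_coe (a := x) (b := f.toPreGNS (star x))
  rw [h, _root_.zero_apply] at h3
  have h4 := f.preGNS_norm_sq (f.toPreGNS (x * star x))
  rw [PositiveLinearMap.ofPreGNS_toPreGNS] at h4
  rw [← h4]
  have h5 : ‖(f.leftMulMapPreGNS x) (f.toPreGNS (star x))‖ = 0 := by
    rw [← UniformSpace.Completion.norm_coe, ← h3, norm_zero]
  have h6 : (f.leftMulMapPreGNS x) (f.toPreGNS (star x)) = f.toPreGNS (x * star x) := by simp
  rw [← h6, h5]; simp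
end rep

lemma csn_of_rep {T V : Type} [NonUnitalRing T] [Module ℂ T] [StarRing T] [NormedAddCommGroup V]
    [InnerProductSpace ℂ V] (Ψ : T →ₗ[ℂ] V →L[ℂ] V) (hm : ∀ x y, Ψ (x * y) = Ψ x * Ψ y)
    (ha : ∀ x v w, inner ℂ (Ψ x v) w = inner ℂ v (Ψ (star x) w)) : CSn (fun z => ‖Ψ z‖) := by
  refine CSn.ofSq (fun z => norm_nonneg (Ψ z)) (fun x y => ?_) (fun c x => ?_) (fun x y => ?_) (fun x => ?_)
  · rw [map_add]; exact norm_add_le _ _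
  · rw [map_smul, norm_smul]
  · rw [hm]; exact norm_mul_le _ _
  · have : ‖Ψ x‖ ≤ √ ‖Ψ (star x * x)‖ := by
      refine ContinuousLinearMap.opNorm_le_bound _ (Real.sqrt_nonneg _) fun v => ?_
      refine abs_le_of_sq_le_sq' ?_ (by positivity) |>.2
      rw [mul_pow, Real.sq_sqrt (norm_nonneg _)]
      have h1 : (‖Ψ x v‖ ^ 2 : ℝ) = RCLike.re (inner ℂ v (Ψ (star x * x) v)) := by
        rw [@norm_sq_eq_re_inner ℂ, ha, hm]; rfl
      rw [h1]
      calc _ ≤ ‖inner ℂ v (Ψ (star x * x) v)‖ := RCLike.re_le_norm _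
        _ ≤ ‖v‖ * ‖Ψ (star x * x) v‖ := norm_inner_le_norm _ _
        _ ≤ ‖v‖ * (‖Ψ (star x * x)‖ * ‖v‖) := by gcongr; exact ContinuousLinearMap.le_opNorm _ _
        _ = _ := by ring
    calc _ ≤ √ ‖Ψ (star x * x)‖ ^ 2 := pow_le_pow_left₀ (norm_nonneg _) this 2
      _ = _ := Real.sq_sqrt (norm_nonneg _)

section repnorm
variable {X Y H K : Type} [NonUnitalCStarAlgebra X] [NonUnitalCStarAlgebra Y]
  [NormedAddCommGroup H] [InnerProductSpace ℂ H] [CompleteSpace H]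
  [NormedAddCommGroup K] [InnerProductSpace ℂ K] [CompleteSpace K]

/-- tensor product representation -/
def repT (π : X →⋆ₙₐ[ℂ] (H →L[ℂ] H)) (σ : Y →⋆ₙₐ[ℂ] (K →L[ℂ] K)) :
    X ⊗[ℂ] Y →ₗ[ℂ] (H ⊗[ℂ] K →L[ℂ] H ⊗[ℂ] K) :=
  TensorProduct.lift (LinearMap.mk₂ ℂ (fun x y => TensorProduct.mapL (π x) (σ y))
    (fun a b c => by rw [map_add, TensorProduct.mapL_add_left])
    (fun a b c => by rw [map_smul, TensorProduct.mapL_smul_left])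
    (fun a b c => by rw [map_add, TensorProduct.mapL_add_right])
    (fun a b c => by rw [map_smul, TensorProduct.mapL_smul_right]))

variable (π : X →⋆ₙₐ[ℂ] (H →L[ℂ] H)) (σ : Y →⋆ₙₐ[ℂ] (K →L[ℂ] K))

lemma repT_tmul (x : X) (y : Y) : repT π σ (x ⊗ₜ y) = TensorProduct.mapL (π x) (σ y) := rfl

lemma repT_mul (z w : X ⊗[ℂ] Y) : repT π σ (z * w) = repT π σ z * repT π σ w := by
  induction z with
  | zero => simp
  | add a b ha hb => simp only [add_mul, map_add, ha, hb]
  | tmul x y =>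
    induction w with
    | zero => simp
    | add a b ha hb => simp only [mul_add, map_add, ha, hb]
    | tmul x' y' =>
      rw [Algebra.TensorProduct.tmul_mul_tmul, repT_tmul, repT_tmul, repT_tmul, map_mul, map_mul,
        TensorProduct.mapL_mul]

lemma repT_adj (z : X ⊗[ℂ] Y) (v w : H ⊗[ℂ] K) :
    inner ℂ (repT π σ z v) w = inner ℂ v (repT π σ (star z) w) := by
  induction z with
  | zero => simp
  | add a b ha hb => simp only [star_add, map_add, _root_.add_apply, inner_add_left, inner_add_right, ha, hb]
  | tmul x y =>
    rw [TensorProduct.star_tmul, repT_tmul, repT_tmul]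
    induction v with
    | zero => simp
    | add a b ha hb => simp only [map_add, inner_add_left, ha, hb]
    | tmul h k =>
      induction w with
      | zero => simp
      | add a b ha hb => simp only [map_add, inner_add_right, ha, hb]
      | tmul h' k' =>
        rw [TensorProduct.mapL_tmul, TensorProduct.mapL_tmul, TensorProduct.inner_tmul, TensorProduct.inner_tmul,
          map_star, map_star, ContinuousLinearMap.star_eq_adjoint, ContinuousLinearMap.star_eq_adjoint,
          ContinuousLinearMap.adjoint_inner_right, ContinuousLinearMap.adjoint_inner_right]

lemma repT_csn : CSn (fun z => ‖repT π σ z‖) :=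
  csn_of_rep (repT π σ) (repT_mul π σ) (repT_adj π σ)

lemma repT_cross (x : X) (y : Y) : ‖repT π σ (x ⊗ₜ y)‖ ≤ ‖x‖ * ‖y‖ := by
  rw [repT_tmul]
  refine (TensorProduct.norm_mapL_le _ _).trans ?_
  gcongr
  · exact NonUnitalStarAlgHom.norm_apply_le π x
  · exact NonUnitalStarAlgHom.norm_apply_le σ y

/-- matrix coefficient -/
def coef (π : X →⋆ₙₐ[ℂ] (H →L[ℂ] H)) (v v' : H) : X →ₗ[ℂ] ℂ where
  toFun x := inner ℂ v' (π x v)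
  map_add' a b := by rw [map_add, _root_.add_apply, inner_add_right]
  map_smul' c b := by rw [map_smul, _root_.smul_apply, inner_smul_right]; rfl

lemma coef_apply (π : X →⋆ₙₐ[ℂ] (H →L[ℂ] H)) (v v' : H) (x : X) :
  coef π v v' x = inner ℂ v' (π x v) := rfl

lemma repT_inner (z : X ⊗[ℂ] Y) (v v' : H) (w w' : K) :
    inner ℂ (v' ⊗ₜ[ℂ] w') (repT π σ z (v ⊗ₜ w)) =
      coef σ w w' (TensorProduct.lid ℂ Y (LinearMap.rTensor Y (coef π v v') z)) := by
  induction z with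
  | zero => simp
  | add a b ha hb => simp only [map_add, _root_.add_apply, inner_add_right, ha, hb]
  | tmul x y =>
    rw [repT_tmul, TensorProduct.mapL_tmul, TensorProduct.inner_tmul, LinearMap.rTensor_tmul,
      TensorProduct.lid_tmul, map_smul, coef_apply, coef_apply, smul_eq_mul]

end repnorm

lemma opn_zero {V : Type} [NormedAddCommGroup V] [InnerProductSpace ℂ V] {f : V →L[ℂ] V}
    (h : ‖f‖ = 0) : f = 0 := norm_eq_zero.1 h

section exnorm
variable {X Y : Type} [NonUnitalCStarAlgebra X] [NonUnitalCStarAlgebra Y]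

lemma exists_coef {x : X} (hx : x ≠ 0) :
    ∃ (H : Type) (_ : NormedAddCommGroup H) (_ : InnerProductSpace ℂ H) (_ : CompleteSpace H)
      (π : X →⋆ₙₐ[ℂ] (H →L[ℂ] H)) (v v' : H), coef π v v' x ≠ 0 := by
  obtain ⟨H, i1, i2, i3, π, h⟩ := exists_rep hx
  refine ⟨H, i1, i2, i3, π, ?_⟩
  by_contra! h2
  refine h (ContinuousLinearMap.ext fun v => ?_)
  have := h2 v (π x v)
  rw [coef_apply, inner_self_eq_zero] at this
  exact this

lemma exists_repT_ne {z : X ⊗[ℂ] Y} (hz : z ≠ 0) : ∃ p : X ⊗[ℂ] Y → ℝ, CSn p ∧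
    (∀ x y, p (x ⊗ₜ y) ≤ ‖x‖ * ‖y‖) ∧ p z ≠ 0 := by
  classical
  let b := Module.Basis.ofVectorSpace ℂ Y
  have h1 : TensorProduct.equivFinsuppOfBasisRight b z ≠ 0 := fun h => hz (by simpa using h)
  obtain ⟨k, hk⟩ := Finsupp.ne_iff.1 h1
  obtain ⟨H, i1, i2, i3, π, v, v', h2⟩ := exists_coef hk
  have h3 : ∀ z : X ⊗[ℂ] Y, b.repr (TensorProduct.lid ℂ Y (LinearMap.rTensor Y (coef π v v') z)) k =
      coef π v v' (TensorProduct.equivFinsuppOfBasisRight b z k) := fun z => by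
    induction z with
    | zero => simp
    | add a b ha hb => simp only [map_add, Finsupp.add_apply, ha, hb]
    | tmul x y => simp [mul_comm]
  have h4 : TensorProduct.lid ℂ Y (LinearMap.rTensor Y (coef π v v') z) ≠ 0 := fun h => h2 (by
    rw [← h3, h]; simp)
  obtain ⟨K, j1, j2, j3, σ, w, w', h5⟩ := exists_coef h4
  refine ⟨fun z => ‖repT π σ z‖, repT_csn π σ, repT_cross π σ, fun h => h5 ?_⟩
  rw [← repT_inner, opn_zero h]
  simp

lemma exists_cstarNorm (X Y : Type) [NonUnitalCStarAlgebra X] [NonUnitalCStarAlgebra Y] :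
    ∃ p : X ⊗[ℂ] Y → ℝ, CSn p ∧ ∀ z, p z = 0 → z = 0 := by
  let ι := {p : X ⊗[ℂ] Y → ℝ // CSn p ∧ ∀ x y, p (x ⊗ₜ y) ≤ ‖x‖ * ‖y‖}
  have hb : ∀ z : X ⊗[ℂ] Y, ∃ c, ∀ p : ι, p.1 z ≤ c := fun z => by
    induction z with
    | zero => exact ⟨0, fun p => p.2.1.map_zero.le⟩
    | add a b ha hb =>
      obtain ⟨c, hc⟩ := ha
      obtain ⟨d, hd⟩ := hb
      exact ⟨c + d, fun p => (p.2.1.add_le _ _).trans (add_le_add (hc p) (hd p))⟩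
    | tmul x y => exact ⟨_, fun p => p.2.2 x y⟩
  have hb' : ∀ z : X ⊗[ℂ] Y, BddAbove (Set.range fun p : ι => p.1 z) := fun z => by
    obtain ⟨c, hc⟩ := hb z
    exact ⟨c, by rintro _ ⟨p, rfl⟩; exact hc p⟩
  have _ : Nonempty ι := ⟨⟨fun _ => 0, ⟨fun _ => le_rfl, by simp, by simp, by simp, by simp⟩, fun x y => by positivity⟩⟩
  refine ⟨fun z => ⨆ p : ι, p.1 z, CSn.iSup (fun p => p.2.1) hb', fun z hz => ?_⟩
  by_contra h
  obtain ⟨p, h1, h2, h3⟩ := exists_repT_ne h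
  refine h3 (le_antisymm ?_ (h1.nonneg _))
  rw [← hz]
  exact le_ciSup (hb' z) (⟨p, h1, h2⟩ : ι)

end exnorm
end

noncomputable section
open scoped TensorProduct
set_option linter.unusedSectionVars false

lemma csn_of_hom {T Q : Type} [NonUnitalRing T] [Module ℂ T] [StarRing T] [NonUnitalCStarAlgebra Q]
    (Ψ : T →ₗ[ℂ] Q) (hm : ∀ x y, Ψ (x * y) = Ψ x * Ψ y)
    (ha : ∀ x, Ψ (star x) = star (Ψ x)) : CSn (fun z => ‖Ψ z‖) := by
  refine ⟨fun z => norm_nonneg (Ψ z), fun x y => ?_, fun c x => ?_, fun x y => ?_, fun x => ?_⟩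
  · rw [map_add]; exact norm_add_le _ _
  · rw [map_smul, norm_smul]
  · rw [hm]; exact norm_mul_le _ _
  · rw [hm, ha, CStarRing.norm_star_mul_self, sq]

lemma csn_comap {T S : Type} [NonUnitalRing T] [Module ℂ T] [StarRing T] [NonUnitalRing S]
    [Module ℂ S] [StarRing S] {γ : S → ℝ} (h : CSn γ)
    (Ψ : T →ₗ[ℂ] S) (hm : ∀ x y, Ψ (x * y) = Ψ x * Ψ y)
    (ha : ∀ x, Ψ (star x) = star (Ψ x)) : CSn (fun z => γ (Ψ z)) := by
  refine ⟨fun z => h.nonneg (Ψ z), fun x y => ?_, fun c x => ?_, fun x y => ?_, fun x => ?_⟩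
  · rw [map_add]; exact h.add_le _ _
  · rw [map_smul, h.smul]
  · rw [hm]; exact h.mul_le _ _
  · rw [hm, ha, h.cstar]

lemma CSn.max {T : Type} [NonUnitalRing T] [Module ℂ T] [StarRing T] {γ δ : T → ℝ} (h : CSn γ)
    (h' : CSn δ) : CSn (fun x => max (γ x) (δ x)) := by
  refine CSn.ofSq (fun x => le_max_of_le_left (h.nonneg x)) (fun x y => max_le ?_ ?_) (fun c x => ?_)
    (fun x y => max_le ?_ ?_) (fun x => ?_)
  · exact (h.add_le _ _).trans (add_le_add (le_max_left _ _) (le_max_left _ _))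
  · exact (h'.add_le _ _).trans (add_le_add (le_max_right _ _) (le_max_right _ _))
  · rw [h.smul, h'.smul, mul_max_of_nonneg _ _ (norm_nonneg _)]
  · exact (h.mul_le _ _).trans (mul_le_mul (le_max_left _ _) (le_max_left _ _) (h.nonneg _) (le_max_of_le_left (h.nonneg _)))
  · exact (h'.mul_le _ _).trans (mul_le_mul (le_max_right _ _) (le_max_right _ _) (h'.nonneg _) (le_max_of_le_left (h.nonneg _)))
  · rcases max_cases (γ x) (δ x) with ⟨h1, -⟩ | ⟨h1, -⟩
    · rw [h1, ← h.cstar]; exact le_max_left _ _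
    · rw [h1, ← h'.cstar]; exact le_max_right _ _

section ext
variable {A R F : Type} [NonUnitalCStarAlgebra A] [NonUnitalCStarAlgebra F]
  [NonUnitalRing R] [Module ℂ R] [IsScalarTower ℂ R R]
    [SMulCommClass ℂ R R] [StarRing R] [StarModule ℂ R]

lemma ext_csn (j : R →⋆ₙₐ[ℂ] F) (hj : DenseRange j) {γ : A ⊗[ℂ] R → ℝ} (h : CSn γ)
    (hc : ∀ a y, γ (a ⊗ₜ y) ≤ ‖a‖ * ‖j y‖) :
    ∃ γ' : A ⊗[ℂ] F → ℝ, CSn γ' ∧ (∀ x, γ' (LinearMap.lTensor A (j : R →ₗ[ℂ] F) x) = γ x) ∧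
      ∀ a f, γ' (a ⊗ₜ f) ≤ ‖a‖ * ‖f‖ := by
  obtain ⟨Q, _, φ, -, hφ⟩ := h.exists_completion
  let jl : R →ₗ[ℂ] F := (j : R →ₗ[ℂ] F)
  have hjl : DenseRange jl := hj
  let ψ : A → R →ₗ[ℂ] Q := fun a => (φ : A ⊗[ℂ] R →ₗ[ℂ] Q) ∘ₗ TensorProduct.mk ℂ A R a
  have hψ : ∀ a y, ψ a y = φ (a ⊗ₜ y) := fun a y => rfl
  have hψb : ∀ a y, ‖ψ a y‖ ≤ ‖a‖ * ‖jl y‖ := fun a y => by rw [hψ, hφ]; exact hc a y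
  let Φ : A → F →L[ℂ] Q := fun a => (ψ a).extendOfNorm jl
  have hΦ : ∀ a y, Φ a (jl y) = φ (a ⊗ₜ y) := fun a y =>
    LinearMap.extendOfNorm_eq hjl ⟨_, hψb a⟩ y
  have hΦb : ∀ a f, ‖Φ a f‖ ≤ ‖a‖ * ‖f‖ := fun a f =>
    LinearMap.norm_extendOfNorm_apply_le hjl _ (hψb a) f
  have hadd : ∀ a b f, Φ (a + b) f = Φ a f + Φ b f := fun a b f => by
    refine hjl.induction_on f (isClosed_eq (by fun_prop) (by fun_prop)) fun y => ?_
    rw [hΦ, hΦ, hΦ, TensorProduct.add_tmul, map_add]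
  have hsmul : ∀ (c : ℂ) a f, Φ (c • a) f = c • Φ a f := fun c a f => by
    refine hjl.induction_on f (isClosed_eq (by fun_prop) (by fun_prop)) fun y => ?_
    rw [hΦ, hΦ, ← TensorProduct.smul_tmul', map_smul]
  have hmul : ∀ a b f g, Φ (a * b) (f * g) = Φ a f * Φ b g := fun a b f g => by
    refine hjl.induction_on f (isClosed_eq (by fun_prop) (by fun_prop)) fun y => ?_
    refine hjl.induction_on g (isClosed_eq (by fun_prop) (by fun_prop)) fun z => ?_
    have : jl y * jl z = jl (y * z) := (map_mul j y z).symm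
    rw [hΦ, hΦ, this, hΦ, ← map_mul, Algebra.TensorProduct.tmul_mul_tmul]
  have hstar : ∀ a f, Φ (star a) (star f) = star (Φ a f) := fun a f => by
    refine hjl.induction_on f (isClosed_eq (by fun_prop) (by fun_prop)) fun y => ?_
    have : star (jl y) = jl (star y) := (map_star j y).symm
    rw [hΦ, this, hΦ, ← map_star, TensorProduct.star_tmul]
  let Ψ : A ⊗[ℂ] F →ₗ[ℂ] Q := TensorProduct.lift (LinearMap.mk₂ ℂ (fun a f => Φ a f) hadd hsmul
    (fun a f g => map_add _ _ _) (fun c a f => map_smul _ _ _))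
  have hΨ : ∀ a f, Ψ (a ⊗ₜ f) = Φ a f := fun a f => rfl
  refine ⟨fun z => ‖Ψ z‖, csn_of_hom Ψ (fun z w => ?_) (fun z => ?_), fun x => ?_, hΦb⟩
  · induction z with
    | zero => simp
    | add a b ha hb => simp only [add_mul, map_add, ha, hb]
    | tmul x y =>
      induction w with
      | zero => simp
      | add a b ha hb => simp only [mul_add, map_add, ha, hb]
      | tmul x' y' => rw [Algebra.TensorProduct.tmul_mul_tmul, hΨ, hΨ, hΨ, hmul]
  · induction z with
    | zero => simp
    | add a b ha hb => simp only [star_add, map_add, ha, hb]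
    | tmul x y => rw [TensorProduct.star_tmul, hΨ, hΨ, hstar]
  · have : Ψ (LinearMap.lTensor A jl x) = φ x := by
      induction x with
      | zero => simp
      | add a b ha hb => simp only [map_add, ha, hb]
      | tmul x y => rw [LinearMap.lTensor_tmul, hΨ, hΦ]
    change ‖Ψ (LinearMap.lTensor A jl x)‖ = _
    rw [this, hφ]

end ext

section conv
variable {A D E : Type} [NonUnitalCStarAlgebra A] [NonUnitalCStarAlgebra D] [NonUnitalCStarAlgebra E]

lemma IsTensorStar.eq {s : A ⊗[ℂ] D →+ A ⊗[ℂ] D} (hs : IsTensorStar s) (x) : s x = star x := by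
  induction x with
  | zero => simp
  | add a b ha hb => simp only [star_add, map_add, ha, hb]
  | tmul x y => rw [hs, TensorProduct.star_tmul]

lemma IsTensorStarRel.eq {T : Type} [NonUnitalRing T] [Module ℂ T] [StarRing T] [StarModule ℂ T]
    {s₂ : T →+ T} (h2 : ∀ x, s₂ x = star x)
    {s : T ⊗[ℂ] D →+ T ⊗[ℂ] D} (hs : IsTensorStarRel s₂ s) (x) : s x = star x := by
  induction x with
  | zero => simp
  | add a b ha hb => simp only [star_add, map_add, ha, hb]
  | tmul x y => rw [hs, TensorProduct.star_tmul, h2]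

lemma csn_iff {T : Type} [NonUnitalRing T] [Module ℂ T] [StarRing T] {s : T →+ T}
    (hs : ∀ x, s x = star x) {γ : T → ℝ} : IsCStarSeminorm s γ ↔ CSn γ :=
  ⟨fun h => ⟨h.1, h.2, h.3, h.4, fun x => by rw [← hs, h.5]⟩,
   fun h => ⟨h.1, h.2, h.3, h.4, fun x => by rw [hs, h.5]⟩⟩

lemma cn_iff {T : Type} [NonUnitalRing T] [Module ℂ T] [StarRing T] {s : T →+ T}
    (hs : ∀ x, s x = star x) {γ : T → ℝ} : IsCStarNorm s γ ↔ CSn γ ∧ ∀ x, γ x = 0 → x = 0 :=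
  ⟨fun h => ⟨(csn_iff hs).1 h.1, h.2⟩, fun h => ⟨(csn_iff hs).2 h.1, h.2⟩⟩

/-- the star as an additive map -/
def starH (T : Type) [NonUnitalRing T] [StarRing T] : T →+ T := (starAddEquiv : T ≃+ T)

lemma starH_apply {T : Type} [NonUnitalRing T] [StarRing T] (x : T) : starH T x = star x := rfl

lemma starH_ts : IsTensorStar (starH (A ⊗[ℂ] D)) := fun a d => by
  rw [starH_apply, TensorProduct.star_tmul]

variable (hD : IsNuclearCStarAlgebra D)
include hD

lemma nuc_eq {ν q : D ⊗[ℂ] E → ℝ} (hν : CSn ν) (hν0 : ∀ x, ν x = 0 → x = 0)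
    (hq : CSn q) (hq0 : ∀ x, q x = 0 → x = 0) : q = ν :=
  hD E (starH _) q ν starH_ts ((cn_iff starH_apply).2 ⟨hq, hq0⟩) ((cn_iff starH_apply).2 ⟨hν, hν0⟩)

lemma nuc_le {ν q : D ⊗[ℂ] E → ℝ} (hν : CSn ν) (hν0 : ∀ x, ν x = 0 → x = 0)
    (hq : CSn q) (y) : q y ≤ ν y := by
  have := nuc_eq hD hν hν0 (hq.max hν) fun x hx => hν0 x
    (le_antisymm (by rw [← hx]; exact le_max_right _ _) (hν.nonneg _))
  rw [← this]
  exact le_max_left _ _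

lemma act_le {ν : D ⊗[ℂ] E → ℝ} (hν : CSn ν) (hν0 : ∀ x, ν x = 0 → x = 0)
    {γ : A ⊗[ℂ] (D ⊗[ℂ] E) → ℝ} (h : CSn γ) (y w) : γ (actR A (D ⊗[ℂ] E) y w) ≤ ν y * γ w := by
  have hb : ∀ y : D ⊗[ℂ] E, ∃ c : ℝ, 0 ≤ c ∧ ∀ w ∈ Set.univ, γ (actR A (D ⊗[ℂ] E) y w) ≤ c * γ w :=
    fun y => by simpa using actR_bdd h y
  have h1 := qW_csn h (IsAct.mulSelf (A := D ⊗[ℂ] E)).lT (fun _ _ _ => Set.mem_univ _) hb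
  exact (le_qW h hb y (Set.mem_univ w)).trans (mul_le_mul_of_nonneg_right (nuc_le hD hν hν0 h1 y) (h.nonneg _))

lemma cross_le {ν : D ⊗[ℂ] E → ℝ} (hν : CSn ν) (hν0 : ∀ x, ν x = 0 → x = 0)
    {γ : A ⊗[ℂ] (D ⊗[ℂ] E) → ℝ} (h : CSn γ) (a y) : γ (a ⊗ₜ y) ≤ ‖a‖ * ν y := by
  refine CSn.le_of_sq (h.nonneg _) (mul_nonneg (norm_nonneg _) (hν.nonneg _)) ?_
  have h1 : star (star (a ⊗ₜ[ℂ] y)) * star (a ⊗ₜ[ℂ] y) =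
      actL A (D ⊗[ℂ] E) a (actR A (D ⊗[ℂ] E) y (star (a ⊗ₜ[ℂ] y))) := by
    simp
  rw [← h.map_star, ← h.cstar, h1, mul_assoc]
  exact ((IsAct.mulSelf (A := A)).rT.bound h _ _).trans
    (mul_le_mul_of_nonneg_left (act_le hD hν hν0 h _ _) (norm_nonneg _))

end conv
end

noncomputable section
open scoped TensorProduct
set_option linter.unusedSectionVars false

lemma loc_comm {S : Type} [CommCStarAlgebra S] {ι : Type} (s : Finset ι) (b : ι → S) {i : ι}
    (hi : b i ≠ 0) : ∃ β : ι → ℂ, β i ≠ 0 ∧ ∀ ε : ℝ, 0 < ε → ∃ g g' : S, g' * g = g ∧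
      g * b i ≠ 0 ∧ ∀ k ∈ s, ‖(b k - algebraMap ℂ S (β k)) * g'‖ ≤ 2 * ε := by
  let G := gelfandStarTransform S
  have hG : ∀ x, ‖G x‖ = ‖x‖ := fun x => by
    have := (gelfandTransform_isometry S).norm_map_of_map_zero (map_zero _) x
    exact this
  have h1 : G (b i) ≠ 0 := by
    rw [← norm_ne_zero_iff, hG, norm_ne_zero_iff]; exact hi
  obtain ⟨χ, hχ⟩ : ∃ χ, G (b i) χ ≠ 0 := by
    by_contra! h
    exact h1 (ContinuousMap.ext h)
  refine ⟨fun k => G (b k) χ, hχ, fun ε hε => ?_⟩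
  let m : WeakDual.characterSpace ℂ S → ℝ := fun x => ∑ k ∈ s, ‖G (b k) x - G (b k) χ‖
  have hm : Continuous m := by fun_prop
  have hm0 : m χ = 0 := by simp [m]
  let p : C(WeakDual.characterSpace ℂ S, ℂ) := ⟨fun x => ((max 0 (1 - m x / ε) : ℝ) : ℂ), by fun_prop⟩
  let p' : C(WeakDual.characterSpace ℂ S, ℂ) :=
    ⟨fun x => ((min 1 (max 0 (2 - m x / ε)) : ℝ) : ℂ), by fun_prop⟩
  have hp : ∀ x, p x = ((max 0 (1 - m x / ε) : ℝ) : ℂ) := fun _ => rfl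
  have hp' : ∀ x, p' x = ((min 1 (max 0 (2 - m x / ε)) : ℝ) : ℂ) := fun _ => rfl
  refine ⟨G.symm p, G.symm p', ?_, ?_, fun k hk => ?_⟩
  · rw [← map_mul]
    congr 1
    ext x
    rw [ContinuousMap.mul_apply, hp, hp', ← Complex.ofReal_mul]
    congr 1
    rcases le_total (m x / ε) 1 with h | h
    · rw [min_eq_left (le_max_of_le_right (by linarith)), one_mul]
    · rw [max_eq_left (a := (0:ℝ)) (b := 1 - m x / ε) (by linarith), mul_zero]
  · intro h
    have h2 : G (G.symm p * b i) χ = 0 := by rw [h, map_zero]; rfl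
    rw [map_mul, G.apply_symm_apply, ContinuousMap.mul_apply, hp, hm0] at h2
    simp at h2
    exact hχ h2
  · rw [← hG, map_mul, G.apply_symm_apply, ContinuousMap.norm_le _ (by positivity)]
    intro x
    have h3 : G (algebraMap ℂ S (G (b k) χ)) x = G (b k) χ := by
      rw [AlgHomClass.commutes]; rfl
    rw [ContinuousMap.mul_apply, map_sub, ContinuousMap.sub_apply, h3, hp', norm_mul, Complex.norm_real,
      Real.norm_of_nonneg (le_min zero_le_one (le_max_left _ _))]
    have h4 : ‖G (b k) x - G (b k) χ‖ ≤ m x :=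
      Finset.single_le_sum (f := fun k => ‖G (b k) x - G (b k) χ‖) (fun _ _ => norm_nonneg _) hk
    rcases le_total (m x) (2 * ε) with h | h
    · calc _ ≤ ‖G (b k) x - G (b k) χ‖ * 1 :=
            mul_le_mul_of_nonneg_left (min_le_left _ _) (norm_nonneg _)
        _ ≤ _ := by linarith
    · have : 2 ≤ m x / ε := by rw [le_div_iff₀ hε]; exact h
      rw [max_eq_left (by linarith), min_eq_right zero_le_one, mul_zero]; positivity

lemma loc_gen {U : Type} [CStarAlgebra U] {ι : Type} (s : Finset ι) (b : ι → U)
    (hc : ∀ k l, b k * b l = b l * b k) (hs : ∀ k l, b k * star (b l) = star (b l) * b k) {i : ι}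
    (hi : b i ≠ 0) : ∃ β : ι → ℂ, β i ≠ 0 ∧ ∀ ε : ℝ, 0 < ε → ∃ g g' : U, g' * g = g ∧
      g * b i ≠ 0 ∧ ∀ k ∈ s, ‖(b k - algebraMap ℂ U (β k)) * g'‖ ≤ 2 * ε := by
  let S := (StarAlgebra.adjoin ℂ (Set.range b)).topologicalClosure
  have hS : ∀ x y : S, x * y = y * x := by
    let _ := StarSubalgebra.commRingTopologicalClosure (StarAlgebra.adjoin ℂ (Set.range b)) (by
      let _ := StarAlgebra.adjoinCommRingOfComm ℂ (s := Set.range b)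
        (by rintro _ ⟨k, rfl⟩ _ ⟨l, rfl⟩; exact hc k l)
        (by rintro _ ⟨k, rfl⟩ _ ⟨l, rfl⟩; exact hs k l)
      exact fun x y => mul_comm x y)
    exact fun x y => mul_comm x y
  have hcl : IsClosed (S : Set U) := StarSubalgebra.isClosed_topologicalClosure _
  let _ : CStarAlgebra S := StarSubalgebra.cstarAlgebra S (h_closed := hcl)
  let _ : CommCStarAlgebra S := { (inferInstance : CStarAlgebra S) with mul_comm := hS }
  let b' : ι → S := fun k => ⟨b k, StarSubalgebra.le_topologicalClosure _
    (StarAlgebra.subset_adjoin ℂ _ ⟨k, rfl⟩)⟩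
  obtain ⟨β, h0, h⟩ := loc_comm s b' (i := i) (fun h => hi (congrArg Subtype.val h))
  refine ⟨β, h0, fun ε hε => ?_⟩
  obtain ⟨g, g', h1, h2, h3⟩ := h ε hε
  refine ⟨g, g', congrArg Subtype.val h1, fun h => h2 (Subtype.ext h), fun k hk => h3 k hk⟩
end

noncomputable section
open scoped TensorProduct
set_option linter.unusedSectionVars false

lemma min_supp {A F κ : Type} [NonUnitalCStarAlgebra A] [NonUnitalCStarAlgebra F]
    (f : Module.Basis κ ℂ F) {γ : A ⊗[ℂ] F → ℝ} (h : CSn γ) (hz : ∃ z, z ≠ 0 ∧ γ z = 0) :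
    ∃ a : κ →₀ A, a ≠ 0 ∧ γ (∑ k ∈ a.support, a k ⊗ₜ f k) = 0 ∧
      ∀ i k c, a i * c * a k = a k * c * a i := by
  classical
  let e : A ⊗[ℂ] F ≃ₗ[ℂ] (κ →₀ A) := TensorProduct.equivFinsuppOfBasisRight f
  have he : ∀ (L : A →ₗ[ℂ] A) z k, e (L.rTensor F z) k = L (e z k) := fun L z k => by
    induction z with
    | zero => simp
    | add a b ha hb => simp only [map_add, Finsupp.add_apply, ha, hb]
    | tmul x y => simp [e]
  have hex : ∃ n, ∃ z, z ≠ 0 ∧ γ z = 0 ∧ (e z).support.card = n := by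
    obtain ⟨z, h1, h2⟩ := hz
    exact ⟨_, z, h1, h2, rfl⟩
  obtain ⟨z, hz0, hzγ, hzn⟩ := Nat.find_spec hex
  have hmin : ∀ z', γ z' = 0 → (e z').support ⊂ (e z).support → z' = 0 := fun z' h1 h2 => by
    by_contra h3
    exact Nat.find_min hex (hzn ▸ Finset.card_lt_card h2) ⟨z', h3, h1, rfl⟩
  have hl : ∀ c z, γ z = 0 → γ ((LinearMap.mulLeft ℂ c).rTensor F z) = 0 := fun c z h1 => by
    refine le_antisymm ?_ (h.nonneg _)
    have := ((IsAct.mulSelf (A := A)).rT (A := F)).bound h c z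
    rw [h1, mul_zero] at this
    exact this
  have hr' : ∀ (c : A) (z : A ⊗[ℂ] F), (LinearMap.mulRight ℂ c).rTensor F z =
      star ((LinearMap.mulLeft ℂ (star c)).rTensor F (star z)) := fun c z => by
    induction z with
    | zero => simp
    | add a b ha hb => simp only [map_add, star_add, ha, hb]
    | tmul x y => simp
  have hr : ∀ c z, γ z = 0 → γ ((LinearMap.mulRight ℂ c).rTensor F z) = 0 := fun c z h1 => by
    rw [hr', h.map_star]
    exact hl _ _ (by rw [h.map_star, h1])
  have key : ∀ i, e z i ≠ 0 → ∀ k c, e z i * c * e z k = e z k * c * e z i := by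
    intro i hi k c
    let z' := (LinearMap.mulLeft ℂ (e z i * c)).rTensor F z - (LinearMap.mulRight ℂ (c * e z i)).rTensor F z
    have hez' : ∀ k, e z' k = e z i * c * e z k - e z k * c * e z i := fun k => by
      simp only [z', map_sub, Finsupp.sub_apply, he, LinearMap.mulLeft_apply, LinearMap.mulRight_apply,
        mul_assoc]
    have h1 : γ z' = 0 := by
      refine le_antisymm ?_ (h.nonneg _)
      have := h.sub_le ((LinearMap.mulLeft ℂ (e z i * c)).rTensor F z)
        ((LinearMap.mulRight ℂ (c * e z i)).rTensor F z)
      rw [hl _ _ hzγ, hr _ _ hzγ, add_zero] at this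
      exact this
    have h2 : z' = 0 := by
      refine hmin z' h1 ⟨fun k hk => ?_, fun hs => ?_⟩
      · rw [Finsupp.mem_support_iff] at hk ⊢
        intro h0
        rw [hez', h0] at hk
        simp at hk
      · have := hs (Finsupp.mem_support_iff.2 hi)
        rw [Finsupp.mem_support_iff, hez', sub_self] at this
        exact this rfl
    have h3 := hez' k
    rw [h2, map_zero, Finsupp.zero_apply] at h3
    exact sub_eq_zero.1 h3.symm
  refine ⟨e z, by simpa using hz0, ?_, fun i k c => ?_⟩
  · have : e.symm (e z) = ∑ k ∈ (e z).support, e z k ⊗ₜ f k :=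
      TensorProduct.equivFinsuppOfBasisRight_symm_apply f (e z)
    rw [← this, e.symm_apply_apply, hzγ]
  · by_cases hi : e z i = 0
    · by_cases hk : e z k = 0
      · rw [hi, hk]
      · exact (key k hk i c).symm
    · exact key i hi k c

section
variable {A D E : Type} [NonUnitalCStarAlgebra A] [NonUnitalCStarAlgebra D] [NonUnitalCStarAlgebra E]

lemma tmul_ne {X Y : Type} [AddCommGroup X] [Module ℂ X] [AddCommGroup Y] [Module ℂ Y] {x : X} {y : Y}
    (hx : x ≠ 0) (h : x ⊗ₜ[ℂ] y = 0) : y = 0 := by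
  obtain ⟨φ, hφ⟩ : ∃ φ : Module.Dual ℂ X, φ x ≠ 0 := by
    by_contra! h1
    exact hx ((Module.forall_dual_apply_eq_zero_iff ℂ x).1 h1)
  have h2 := congrArg (fun z => TensorProduct.lid ℂ Y (φ.rTensor Y z)) h
  simpa [hφ] using h2

lemma nu_le (hD : IsNuclearCStarAlgebra D) {ν : D ⊗[ℂ] E → ℝ} (hν : CSn ν) (hν0 : ∀ x, ν x = 0 → x = 0)
    {γ : A ⊗[ℂ] (D ⊗[ℂ] E) → ℝ} (h : CSn γ) (h0 : ∀ x, γ x = 0 → x = 0) {c : A} (hc : c ≠ 0)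
    (y : D ⊗[ℂ] E) {r : ℝ} (hr : 0 ≤ r)
    (hy : ∀ t, γ (actR A (D ⊗[ℂ] E) y (actL A (D ⊗[ℂ] E) c t)) ≤ r * γ (actL A (D ⊗[ℂ] E) c t)) :
    ν y ≤ r := by
  let W : Set (A ⊗[ℂ] (D ⊗[ℂ] E)) := Set.range (actL A (D ⊗[ℂ] E) c)
  have hcomm : ∀ y t, actR A (D ⊗[ℂ] E) y (actL A (D ⊗[ℂ] E) c t) =
      actL A (D ⊗[ℂ] E) c (actR A (D ⊗[ℂ] E) y t) := fun y t => by
    induction t with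
    | zero => simp
    | add a b ha hb => simp only [map_add, ha, hb]
    | tmul x z => simp
  have hb : ∀ y : D ⊗[ℂ] E, ∃ c : ℝ, 0 ≤ c ∧ ∀ w ∈ W, γ (actR A (D ⊗[ℂ] E) y w) ≤ c * γ w :=
    fun y => by
      obtain ⟨d, hd, h1⟩ := actR_bdd h y
      exact ⟨d, hd, fun w _ => h1 w⟩
  have h1 := qW_csn h (IsAct.mulSelf (A := D ⊗[ℂ] E)).lT (W := W)
    (by rintro y _ ⟨t, rfl⟩; exact ⟨_, (hcomm y t).symm⟩) hb
  have h2 := nuc_eq hD hν hν0 h1 fun y hy => by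
    have h3 := le_qW h hb y (w := actL A (D ⊗[ℂ] E) c (star c ⊗ₜ star y)) ⟨_, rfl⟩
    have h4 : qW γ (actR A (D ⊗[ℂ] E)) W y = 0 := hy
    rw [h4, zero_mul] at h3
    have h5 := h0 _ (le_antisymm h3 (h.nonneg _))
    have h6 : (c * star c) ⊗ₜ[ℂ] (y * star y) = 0 := by simpa using h5
    have h7 := tmul_ne (by simpa using hc) h6
    have h8 := hν.cstar (star y)
    rw [star_star, h7, hν.map_zero, hν.map_star] at h8
    exact hν0 _ (by simpa using h8.symm)
  rw [← h2]
  exact qW_le hr (by rintro _ ⟨t, rfl⟩; exact hy t)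
end
end

noncomputable section
open scoped TensorProduct
set_option linter.unusedSectionVars false

section
variable {A D E F : Type} [NonUnitalCStarAlgebra A] [NonUnitalCStarAlgebra D] [NonUnitalCStarAlgebra E]
  [NonUnitalCStarAlgebra F]

lemma act_comm {R : Type} [NonUnitalRing R] [Module ℂ R] [IsScalarTower ℂ R R] [SMulCommClass ℂ R R]
    (c : A) (y : R) (t) : actR A R y (actL A R c t) = actL A R c (actR A R y t) := by
  induction t with
  | zero => simp
  | add a b ha hb => simp only [map_add, ha, hb]
  | tmul x z => simp

lemma act_mul {R : Type} [NonUnitalRing R] [Module ℂ R] [IsScalarTower ℂ R R] [SMulCommClass ℂ R R]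
    (c : A) (y : R) (t) : actL A R c (actR A R y t) = (c ⊗ₜ y) * t := by
  induction t with
  | zero => simp
  | add a b ha hb => simp only [map_add, ha, hb, mul_add]
  | tmul x z => simp

lemma est_fix {C T : Type} [NonUnitalCStarAlgebra C] [NonUnitalRing T] [Module ℂ T] [IsScalarTower ℂ T T]
    [SMulCommClass ℂ T T] [StarRing T] [StarModule ℂ T] {M : C →ₗ[ℂ] T →ₗ[ℂ] T} (hM : IsAct M)
    (g' : Unitization ℂ C) (c : C) (hc : g' * (c : Unitization ℂ C) = c) (t : T) :
    actU M g' (M c t) = M c t := by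
  rw [← actU_inr M c t, ← hM.actU.mul, hc]

lemma est_gen {C T : Type} [NonUnitalCStarAlgebra C] [NonUnitalRing T] [Module ℂ T] [IsScalarTower ℂ T T]
    [SMulCommClass ℂ T T] [StarRing T] [StarModule ℂ T] {γ : T → ℝ} (h : CSn γ)
    {M : C →ₗ[ℂ] T →ₗ[ℂ] T} (hM : IsAct M) {κ : Type} (s : Finset κ) (b : κ → C) (β : κ → ℂ) {η : ℝ}
    (hη : 0 ≤ η) (g' : Unitization ℂ C)
    (hgk : ∀ k ∈ s, ‖((b k : Unitization ℂ C) - algebraMap ℂ _ (β k)) * g'‖ ≤ η)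
    (v : κ → T) (hv : ∀ k, actU M g' (v k) = v k) :
    γ (∑ k ∈ s, β k • v k) ≤ γ (∑ k ∈ s, M (b k) (v k)) + ∑ k ∈ s, η * γ (v k) := by
  have e1 : ∑ k ∈ s, β k • v k = ∑ k ∈ s, M (b k) (v k) -
      ∑ k ∈ s, actU M (((b k : Unitization ℂ C) - algebraMap ℂ _ (β k)) * g') (v k) := by
    rw [← Finset.sum_sub_distrib]
    refine Finset.sum_congr rfl fun k _ => ?_
    rw [hM.actU.mul, hv, map_sub, LinearMap.sub_apply, actU_inr, Algebra.algebraMap_eq_smul_one,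
      map_smul, LinearMap.smul_apply, actU_one, LinearMap.id_apply]
    abel
  rw [e1]
  refine (h.sub_le _ _).trans (add_le_add le_rfl ((h.sum_le _ _).trans
    (Finset.sum_le_sum fun k hk => ?_)))
  exact (hM.boundU h _ _).trans (mul_le_mul_of_nonneg_right (hgk k hk) (h.nonneg _))

/-- the core estimate -/
lemma core_est (hD : IsNuclearCStarAlgebra D) {ν : D ⊗[ℂ] E → ℝ} (hν : CSn ν)
    (hν0 : ∀ x, ν x = 0 → x = 0) {γ : A ⊗[ℂ] (D ⊗[ℂ] E) → ℝ} (h : CSn γ) (h0 : ∀ x, γ x = 0 → x = 0)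
    {κ : Type} (s : Finset κ) (b : κ → A) (i : κ) (β : κ → ℂ) {η r : ℝ} (hη : 0 ≤ η)
    (g g' : Unitization ℂ A) (hg : g' * g = g) (hgb : g * (b i : Unitization ℂ A) ≠ 0)
    (hgk : ∀ k ∈ s, ‖((b k : Unitization ℂ A) - algebraMap ℂ _ (β k)) * g'‖ ≤ η)
    (y : κ → D ⊗[ℂ] E) (hr : γ (∑ k ∈ s, b k ⊗ₜ y k) ≤ r) :
    ν (∑ k ∈ s, β k • y k) ≤ r + ∑ k ∈ s, η * ν (y k) := by
  obtain ⟨c, hc⟩ : ∃ c : A, (c : Unitization ℂ A) = g * (b i : Unitization ℂ A) := by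
    refine ⟨(g * (b i : Unitization ℂ A)).snd, ?_⟩
    ext <;> simp
  have hc0 : c ≠ 0 := fun h1 => hgb (by rw [← hc, h1, Unitization.inr_zero])
  have hr0 : 0 ≤ r := (h.nonneg _).trans hr
  refine nu_le hD hν hν0 h h0 hc0 _ (add_nonneg hr0 (Finset.sum_nonneg fun k _ =>
    mul_nonneg hη (hν.nonneg _))) fun t => ?_
  have hM : IsAct (R := A) (T := A ⊗[ℂ] (D ⊗[ℂ] E)) (actL A (D ⊗[ℂ] E)) := (IsAct.mulSelf (A := A)).rT
  set w := actL A (D ⊗[ℂ] E) c t with hw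
  have e0 := est_gen h hM s b β hη g' hgk (fun k => actR A (D ⊗[ℂ] E) (y k) w) fun k => by
    rw [hw, act_comm]
    exact est_fix hM g' _ (by rw [hc, ← mul_assoc, hg]) _
  have e1 : actR A (D ⊗[ℂ] E) (∑ k ∈ s, β k • y k) w = ∑ k ∈ s, β k • actR A (D ⊗[ℂ] E) (y k) w := by
    rw [map_sum, LinearMap.sum_apply]
    simp only [map_smul, LinearMap.smul_apply]
  have e2 : ∑ k ∈ s, actL A (D ⊗[ℂ] E) (b k) (actR A (D ⊗[ℂ] E) (y k) w) =
      (∑ k ∈ s, b k ⊗ₜ y k) * w := by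
    simp only [act_mul]
    exact (Finset.sum_mul s (fun k => b k ⊗ₜ[ℂ] y k) w).symm
  rw [e2] at e0
  rw [e1, add_mul]
  refine e0.trans (add_le_add ((h.mul_le _ _).trans
    (mul_le_mul_of_nonneg_right hr (h.nonneg _))) ?_)
  rw [Finset.sum_mul]
  refine Finset.sum_le_sum fun k hk => ?_
  rw [mul_assoc]
  exact mul_le_mul_of_nonneg_left (act_le hD hν hν0 h _ _) hη

lemma definite_ext (hD : IsNuclearCStarAlgebra D) {ν : D ⊗[ℂ] E → ℝ} (hν : CSn ν)
    (hν0 : ∀ x, ν x = 0 → x = 0) {γ : A ⊗[ℂ] (D ⊗[ℂ] E) → ℝ} (h : CSn γ) (h0 : ∀ x, γ x = 0 → x = 0)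
    (j : D ⊗[ℂ] E →⋆ₙₐ[ℂ] F) (hj : DenseRange j) (hjν : ∀ y, ‖j y‖ = ν y)
    {γ' : A ⊗[ℂ] F → ℝ} (h' : CSn γ')
    (hγ' : ∀ x, γ' (LinearMap.lTensor A (j : D ⊗[ℂ] E →ₗ[ℂ] F) x) = γ x)
    (hcr : ∀ a f, γ' (a ⊗ₜ f) ≤ ‖a‖ * ‖f‖) (z) (hz : γ' z = 0) : z = 0 := by
  by_contra hz0
  let f := Module.Basis.ofVectorSpace ℂ F
  obtain ⟨a, ha0, haz, hac⟩ := min_supp f h' ⟨z, hz0, hz⟩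
  obtain ⟨i, hi⟩ : ∃ i, a i ≠ 0 := by
    by_contra! h1
    exact ha0 (Finsupp.ext h1)
  have hstar : ∀ i k c, star (a i) * c * star (a k) = star (a k) * c * star (a i) := fun i k c => by
    have := congrArg star (hac i k (star c))
    simpa [mul_assoc] using this.symm
  let b : _ → A := fun k => star (a i) * a k
  have hb0 : b i ≠ 0 := by simpa [b] using hi
  have hbc : ∀ k l, b k * b l = b l * b k := fun k l => by
    simp only [b]
    rw [mul_assoc, ← mul_assoc (a k), hac, mul_assoc, mul_assoc]
  have hbs : ∀ k l, b k * star (b l) = star (b l) * b k := fun k l => by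
    simp only [b, star_mul, star_star]
    have e1 : star (a i) * a k * (star (a l) * a i) = star (a i) * (a k * star (a l) * a i) := by
      simp only [mul_assoc]
    have e2 : star (a l) * a i * (star (a i) * a k) = (star (a l) * a i * star (a i)) * a k := by
      simp only [mul_assoc]
    rw [e1, e2, hac, hstar l i]
    simp only [mul_assoc]
  have hbz : γ' (∑ k ∈ a.support, b k ⊗ₜ f k) = 0 := by
    have h1 := ((IsAct.mulSelf (A := A)).rT (A := F)).bound h' (star (a i)) (∑ k ∈ a.support, a k ⊗ₜ f k)
    rw [haz, mul_zero] at h1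
    refine le_antisymm (le_of_eq_of_le ?_ h1) (h'.nonneg _)
    simp [b]
  obtain ⟨β, hβ, hloc⟩ := loc_gen a.support (fun k => (b k : Unitization ℂ A))
    (fun k l => by rw [← Unitization.inr_mul, hbc, Unitization.inr_mul])
    (fun k l => by rw [← Unitization.inr_star, ← Unitization.inr_mul, hbs, Unitization.inr_mul]) (i := i)
    (fun h1 => hb0 (Unitization.inr_injective (by simpa using h1)))
  have main : ∑ k ∈ a.support, β k • f k = 0 := by
    let C : ℝ := ∑ k ∈ a.support, (‖b k‖ + 2 * (‖f k‖ + 1) + ‖β k‖)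
    have hC : 0 ≤ C := Finset.sum_nonneg fun k _ => by positivity
    have hbd : ∀ η : ℝ, 0 < η → η ≤ 1 → ‖∑ k ∈ a.support, β k • f k‖ ≤ C * η := by
      intro η hη hη1
      obtain ⟨g, g', hg, hgb, hgk⟩ := hloc η hη
      have hy : ∀ k, ∃ y, ‖f k - j y‖ ≤ η := fun k => by
        obtain ⟨y, hy⟩ := hj.exists_dist_lt (f k) hη
        exact ⟨y, by rw [← dist_eq_norm]; exact hy.le⟩
      choose y hy using hy
      have hr : γ (∑ k ∈ a.support, b k ⊗ₜ y k) ≤ ∑ k ∈ a.support, ‖b k‖ * η := by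
        have e1 : LinearMap.lTensor A (j : D ⊗[ℂ] E →ₗ[ℂ] F) (∑ k ∈ a.support, b k ⊗ₜ y k) =
            (∑ k ∈ a.support, b k ⊗ₜ f k) - ∑ k ∈ a.support, b k ⊗ₜ (f k - j (y k)) := by
          rw [← Finset.sum_sub_distrib, map_sum]
          refine Finset.sum_congr rfl fun k _ => ?_
          rw [TensorProduct.tmul_sub, sub_sub_cancel]; rfl
        rw [← hγ', e1]
        refine (h'.sub_le _ _).trans ?_
        rw [hbz, zero_add]
        refine (h'.sum_le _ _).trans (Finset.sum_le_sum fun k _ => (hcr _ _).trans ?_)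
        exact mul_le_mul_of_nonneg_left (hy k) (norm_nonneg _)
      have hest := core_est hD hν hν0 h h0 a.support b i β (by positivity) g g' hg hgb hgk y hr
      have e2 : ∑ k ∈ a.support, β k • f k = j (∑ k ∈ a.support, β k • y k) +
          ∑ k ∈ a.support, β k • (f k - j (y k)) := by
        rw [map_sum, ← Finset.sum_add_distrib]
        refine Finset.sum_congr rfl fun k _ => ?_
        rw [map_smul, ← smul_add, add_sub_cancel]
      rw [e2]
      refine (norm_add_le _ _).trans ?_
      rw [hjν]
      refine (add_le_add hest (norm_sum_le _ _)).trans ?_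
      rw [← Finset.sum_add_distrib, ← Finset.sum_add_distrib, Finset.sum_mul]
      refine Finset.sum_le_sum fun k _ => ?_
      rw [norm_smul]
      have e3 : ν (y k) ≤ ‖f k‖ + 1 := by
        rw [← hjν]
        have : j (y k) = f k - (f k - j (y k)) := by abel
        rw [this]
        exact (norm_sub_le _ _).trans (add_le_add le_rfl ((hy k).trans hη1))
      have e4 := mul_le_mul_of_nonneg_left (hy k) (norm_nonneg (β k))
      have e5 := mul_le_mul_of_nonneg_left e3 hη.le
      nlinarith
    by_contra hne
    have hp : 0 < ‖∑ k ∈ a.support, β k • f k‖ := norm_pos_iff.2 hne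
    set N := ‖∑ k ∈ a.support, β k • f k‖
    let η : ℝ := min 1 (N / (2 * (C + 1)))
    have h1 := hbd η (by positivity) (min_le_left _ _)
    have h2 : C * η ≤ C * (N / (2 * (C + 1))) := mul_le_mul_of_nonneg_left (min_le_right _ _) hC
    have h3 : C * (N / (2 * (C + 1))) < N := by
      rw [← mul_div_assoc, div_lt_iff₀ (by positivity)]
      nlinarith
    linarith
  have hli := linearIndependent_iff'.1 f.linearIndependent a.support β main i
    (Finsupp.mem_support_iff.2 hi)
  exact hβ hli
end
end

noncomputable section
open scoped TensorProduct
set_option linter.unusedSectionVars false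

section
variable {A B D E : Type} [NonUnitalCStarAlgebra A] [NonUnitalCStarAlgebra B] [NonUnitalCStarAlgebra D]
  [NonUnitalCStarAlgebra E]

lemma comm_mul' (x y : A ⊗[ℂ] D) : TensorProduct.comm ℂ A D (x * y) =
    TensorProduct.comm ℂ A D x * TensorProduct.comm ℂ A D y := by
  induction x with
  | zero => simp
  | add a b ha hb => simp only [add_mul, map_add, ha, hb]
  | tmul a d =>
    induction y with
    | zero => simp
    | add a b ha hb => simp only [mul_add, map_add, ha, hb]
    | tmul a' d' => simp

lemma comm_star' (x : A ⊗[ℂ] D) : TensorProduct.comm ℂ A D (star x) =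
    star (TensorProduct.comm ℂ A D x) := by
  induction x with
  | zero => simp
  | add a b ha hb => simp only [star_add, map_add, ha, hb]
  | tmul a d => simp

/-- `A ⊗ (D ⊗ E) ≃ (D ⊗ A) ⊗ E` -/
def sig (A D E : Type) [NonUnitalCStarAlgebra A] [NonUnitalCStarAlgebra D]
    [NonUnitalCStarAlgebra E] : A ⊗[ℂ] (D ⊗[ℂ] E) ≃ₗ[ℂ] (D ⊗[ℂ] A) ⊗[ℂ] E :=
  (TensorProduct.assoc ℂ A D E).symm ≪≫ₗ
    TensorProduct.congr (TensorProduct.comm ℂ A D) (LinearEquiv.refl ℂ E)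

@[simp] lemma sig_tmul (a : A) (d : D) (e : E) :
    sig A D E (a ⊗ₜ (d ⊗ₜ e)) = (d ⊗ₜ a) ⊗ₜ e := by simp [sig]

lemma tens_ind {p : A ⊗[ℂ] (D ⊗[ℂ] E) → Prop} (h0 : p 0) (ha : ∀ x y, p x → p y → p (x + y))
    (ht : ∀ a d e, p (a ⊗ₜ (d ⊗ₜ e))) (x) : p x := by
  induction x with
  | zero => exact h0
  | add a b h1 h2 => exact ha _ _ h1 h2
  | tmul a y =>
    induction y with
    | zero => rw [TensorProduct.tmul_zero]; exact h0
    | add y y' h1 h2 => rw [TensorProduct.tmul_add]; exact ha _ _ h1 h2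
    | tmul d e => exact ht a d e

lemma mulgen {T S : Type} [NonUnitalRing T] [Module ℂ T] [NonUnitalRing S] [Module ℂ S] (f : T →ₗ[ℂ] S) :
    (∀ y, f (0 * y) = f 0 * f y) ∧ (∀ y, f (y * 0) = f y * f 0) ∧
    (∀ a b y, f (a * y) = f a * f y → f (b * y) = f b * f y → f ((a + b) * y) = f (a + b) * f y) ∧
    (∀ a b y, f (y * a) = f y * f a → f (y * b) = f y * f b → f (y * (a + b)) = f y * f (a + b)) :=
  ⟨fun y => by simp, fun y => by simp, fun a b y h1 h2 => by rw [add_mul, map_add, map_add, add_mul, h1, h2],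
    fun a b y h1 h2 => by rw [mul_add, map_add, map_add, mul_add, h1, h2]⟩

lemma sig_mul (x y : A ⊗[ℂ] (D ⊗[ℂ] E)) : sig A D E (x * y) = sig A D E x * sig A D E y := by
  have hg := mulgen (T := A ⊗[ℂ] (D ⊗[ℂ] E)) (S := (D ⊗[ℂ] A) ⊗[ℂ] E) (sig A D E : A ⊗[ℂ] (D ⊗[ℂ] E) →ₗ[ℂ] (D ⊗[ℂ] A) ⊗[ℂ] E)
  induction x using tens_ind with
  | h0 => exact hg.1 y
  | ha a b ha hb => exact hg.2.2.1 a b y ha hb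
  | ht a d e =>
    induction y using tens_ind with
    | h0 => exact hg.2.1 _
    | ha a b ha hb => exact hg.2.2.2 _ _ _ ha hb
    | ht a' d' e' => simp

lemma sig_star (x : A ⊗[ℂ] (D ⊗[ℂ] E)) : sig A D E (star x) = star (sig A D E x) := by
  induction x using tens_ind with
  | h0 => simp
  | ha a b ha hb => simp only [star_add, map_add, ha, hb]
  | ht a d e => simp

lemma sig_nat (ρ : A →ₗ[ℂ] B) (x : A ⊗[ℂ] (D ⊗[ℂ] E)) :
    TensorProduct.map (TensorProduct.map (LinearMap.id : D →ₗ[ℂ] D) ρ) (LinearMap.id : E →ₗ[ℂ] E)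
      (sig A D E x) = sig B D E (TensorProduct.map ρ LinearMap.id x) := by
  induction x using tens_ind with
  | h0 => simp
  | ha a b ha hb => simp only [map_add, ha, hb]
  | ht a d e => simp

lemma nb_apply {ρ : A →ₗ[ℂ] B} {K : ℝ} (h : NuclearBound ρ K) {γ : A ⊗[ℂ] D → ℝ} {δ : B ⊗[ℂ] D → ℝ}
    (hγ : CSn γ) (hγ0 : ∀ x, γ x = 0 → x = 0) (hδ : CSn δ) (x) :
    δ (TensorProduct.map ρ (LinearMap.id : D →ₗ[ℂ] D) x) ≤ K * γ x :=
  h D (starH _) (starH _) γ δ starH_ts starH_ts ((cn_iff starH_apply).2 ⟨hγ, hγ0⟩)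
    ((csn_iff starH_apply).2 hδ) x

lemma part1 {ρ : A →ₗ[ℂ] B} {K : ℝ} (h : NuclearBound ρ K) {γ : D ⊗[ℂ] A → ℝ} {δ : D ⊗[ℂ] B → ℝ}
    (hγ : CSn γ) (hγ0 : ∀ x, γ x = 0 → x = 0) (hδ : CSn δ) (x) :
    δ (TensorProduct.map (LinearMap.id : D →ₗ[ℂ] D) ρ x) ≤ K * γ x := by
  have h1 := csn_comap hγ (TensorProduct.comm ℂ A D : A ⊗[ℂ] D →ₗ[ℂ] D ⊗[ℂ] A) comm_mul' comm_star'
  have h2 := csn_comap hδ (TensorProduct.comm ℂ B D : B ⊗[ℂ] D →ₗ[ℂ] D ⊗[ℂ] B) comm_mul' comm_star'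
  have h3 := nb_apply h h1 (fun x hx => by
    have := hγ0 _ hx
    simpa using this) h2 (TensorProduct.comm ℂ D A x)
  have e1 : TensorProduct.comm ℂ B D (TensorProduct.map ρ (LinearMap.id : D →ₗ[ℂ] D)
      (TensorProduct.comm ℂ D A x)) = TensorProduct.map (LinearMap.id : D →ₗ[ℂ] D) ρ x := by
    clear h3
    induction x with
    | zero => simp
    | add a b ha hb => simp only [map_add, ha, hb]
    | tmul a d => simp
  have e2 : TensorProduct.comm ℂ A D (TensorProduct.comm ℂ D A x) = x := by
    rw [← TensorProduct.comm_symm, LinearEquiv.symm_apply_apply]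
  simp only [LinearEquiv.coe_coe] at h3
  rwa [e1, e2] at h3

lemma part2 {ρ : A →ₗ[ℂ] B} {K : ℝ} (hK : NuclearBound ρ K) (hD : IsNuclearCStarAlgebra D)
    {γ : (D ⊗[ℂ] A) ⊗[ℂ] E → ℝ} {δ : (D ⊗[ℂ] B) ⊗[ℂ] E → ℝ}
    (hγ : CSn γ) (hγ0 : ∀ x, γ x = 0 → x = 0) (hδ : CSn δ) (x) :
    δ (TensorProduct.map (TensorProduct.map (LinearMap.id : D →ₗ[ℂ] D) ρ)
              (LinearMap.id : E →ₗ[ℂ] E) x) ≤ K * γ x := by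
  have h1 := csn_comap (T := A ⊗[ℂ] (D ⊗[ℂ] E)) (S := (D ⊗[ℂ] A) ⊗[ℂ] E) hγ (sig A D E : A ⊗[ℂ] (D ⊗[ℂ] E) →ₗ[ℂ] (D ⊗[ℂ] A) ⊗[ℂ] E) sig_mul sig_star
  have h2 := csn_comap (T := B ⊗[ℂ] (D ⊗[ℂ] E)) (S := (D ⊗[ℂ] B) ⊗[ℂ] E) hδ (sig B D E : B ⊗[ℂ] (D ⊗[ℂ] E) →ₗ[ℂ] (D ⊗[ℂ] B) ⊗[ℂ] E) sig_mul sig_star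
  have h10 : ∀ x, γ (sig A D E x) = 0 → x = 0 := fun x hx => by
    have := hγ0 _ hx
    simpa using this
  obtain ⟨ν, hν, hν0⟩ := exists_cstarNorm D E
  obtain ⟨F, _, j, hj, hjν⟩ := hν.exists_completion
  obtain ⟨γ', g1, g2, g3⟩ := ext_csn j hj h1 (fun a y => by rw [hjν]; exact cross_le hD hν hν0 h1 a y)
  obtain ⟨δ', d1, d2, d3⟩ := ext_csn j hj h2 (fun a y => by rw [hjν]; exact cross_le hD hν hν0 h2 a y)
  have g0 := definite_ext hD hν hν0 h1 h10 j hj hjν g1 g2 g3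
  obtain ⟨x, rfl⟩ := (sig A D E).surjective x
  have h3 := nb_apply hK g1 g0 d1 (LinearMap.lTensor A (j : D ⊗[ℂ] E →ₗ[ℂ] F) x)
  have e1 : TensorProduct.map ρ (LinearMap.id : F →ₗ[ℂ] F) (LinearMap.lTensor A (j : D ⊗[ℂ] E →ₗ[ℂ] F) x) =
      LinearMap.lTensor B (j : D ⊗[ℂ] E →ₗ[ℂ] F) (TensorProduct.map ρ LinearMap.id x) := by
    clear h3
    induction x with
    | zero => simp
    | add a b ha hb => simp only [map_add, ha, hb]
    | tmul a d => simp
  rw [e1, d2, g2] at h3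
  rw [sig_nat]
  exact h3
end

end

theorem statement11 {A B D : Type} [NonUnitalCStarAlgebra A] [NonUnitalCStarAlgebra B]
    [NonUnitalCStarAlgebra D]
    (ρ : A →ₗ[ℂ] B) (hρ : IsNuclearMap ρ) (hD : IsNuclearCStarAlgebra D) :
    ∃ K : ℝ, 0 ≤ K ∧
      -- `id_D ⊗ ρ` is bounded from `D ⊗_min A` to `D ⊗_min B`, i.e. it extends
      -- canonically to a bounded linear map between the minimal tensor products
      (∃ (sB : TensorProduct ℂ D B →+ TensorProduct ℂ D B) (δ₀ : TensorProduct ℂ D B → ℝ),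
        IsTensorStar sB ∧ IsCStarNorm sB δ₀ ∧
        ∀ (sA : TensorProduct ℂ D A →+ TensorProduct ℂ D A) (γ : TensorProduct ℂ D A → ℝ),
          IsTensorStar sA → IsCStarNorm sA γ →
          ∀ x, δ₀ (TensorProduct.map (LinearMap.id : D →ₗ[ℂ] D) ρ x) ≤ K * γ x) ∧
      -- and the extension is again nuclear: `(id_D ⊗ ρ) ⊗ id_E` is bounded by `K`
      -- from `(D ⊗ A) ⊗_min E` to `(D ⊗ B) ⊗_max E` for every C*-algebra `E`
      (∀ (E : Type) [NonUnitalCStarAlgebra E],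
        ∀ (s₂ : TensorProduct ℂ D A →+ TensorProduct ℂ D A)
          (t₂ : TensorProduct ℂ D B →+ TensorProduct ℂ D B)
          (s₃ : TensorProduct ℂ (TensorProduct ℂ D A) E →+
            TensorProduct ℂ (TensorProduct ℂ D A) E)
          (t₃ : TensorProduct ℂ (TensorProduct ℂ D B) E →+
            TensorProduct ℂ (TensorProduct ℂ D B) E)
          (γ : TensorProduct ℂ (TensorProduct ℂ D A) E → ℝ)
          (δ : TensorProduct ℂ (TensorProduct ℂ D B) E → ℝ),
          IsTensorStar s₂ → IsTensorStar t₂ → IsTensorStarRel s₂ s₃ → IsTensorStarRel t₂ t₃ →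
          IsCStarNorm s₃ γ → IsCStarSeminorm t₃ δ →
          ∀ x, δ (TensorProduct.map (TensorProduct.map (LinearMap.id : D →ₗ[ℂ] D) ρ)
              (LinearMap.id : E →ₗ[ℂ] E) x) ≤ K * γ x) := by
  obtain ⟨K, hK0, hK⟩ := hρ
  refine ⟨K, hK0, ?_, ?_⟩
  · obtain ⟨δ₀, h1, h2⟩ := exists_cstarNorm D B
    refine ⟨starH _, δ₀, starH_ts, (cn_iff starH_apply).2 ⟨h1, h2⟩, fun sA γ hs hγ x => ?_⟩
    have h3 := (cn_iff hs.eq).1 hγ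
    exact part1 hK h3.1 h3.2 h1 x
  · intro E _ s₂ t₂ s₃ t₃ γ δ hs2 ht2 hs3 ht3 hγ hδ x
    have h3 := (cn_iff (T := (D ⊗[ℂ] A) ⊗[ℂ] E) (hs3.eq hs2.eq)).1 hγ
    have h4 := (csn_iff (T := (D ⊗[ℂ] B) ⊗[ℂ] E) (ht3.eq ht2.eq)).1 hδ
    exact part2 hK hD h3.1 h3.2 h4 x

end
end

section
/- Let ψ : A → E be a *-homomorphism of C*-algebras, let B be a closed two-sided ideal of E, and let b ∈ B be such that the linear map ψb : A → B, x ↦ ψ(x)b, is nuclear. Then ‖ψb‖_nuc ≤ ‖b‖. -/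
/-!
Statement 12 (Lemma 5.2(6)): if `ψ : A → E` is a *-homomorphism, `B ⊴ E` a closed
two-sided ideal and `b ∈ B` is such that `ψb : x ↦ ψ(x) b` is nuclear, then
`‖ψb‖_nuc ≤ ‖b‖`.

The closed two-sided ideal `B` of `E` is presented abstractly as a C*-algebra
together with an ideal embedding `j : B → E`; the map `ψb`, viewed as a linear map
`A → B`, is then any (necessarily unique) `ρ : A →ₗ B` with `j (ρ x) = ψ x * j b`.
-/

noncomputable section
open scoped TensorProduct

/-- Left multiplication by an element of the unitization, as a linear map on `B`. -/
def lmulU {B : Type} [NonUnitalCStarAlgebra B] (U : Unitization ℂ B) : B →ₗ[ℂ] B where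
  toFun x := U.fst • x + U.snd * x
  map_add' x y := by simp only [smul_add, mul_add]; abel
  map_smul' c x := by
    simp only [smul_add, mul_smul_comm, RingHom.id_apply, smul_comm c U.fst x]

theorem inr_lmulU {B : Type} [NonUnitalCStarAlgebra B] (U : Unitization ℂ B) (x : B) :
    ((lmulU U x : B) : Unitization ℂ B) = U * (x : Unitization ℂ B) := by
  ext <;> simp [lmulU]

theorem star_lmulU_mul {B : Type} [NonUnitalCStarAlgebra B] (U : Unitization ℂ B)
    (hU : star U * U = 1) (x y : B) : star (lmulU U x) * lmulU U y = star x * y := by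
  apply Unitization.inr_injective (R := ℂ)
  rw [Unitization.inr_mul, Unitization.inr_star, inr_lmulU, inr_lmulU, star_mul,
    mul_assoc, ← mul_assoc (star U), hU, one_mul, Unitization.inr_mul, Unitization.inr_star]

theorem tensor_star_mul {A B D : Type} [NonUnitalCStarAlgebra A] [NonUnitalCStarAlgebra B]
    [NonUnitalCStarAlgebra D]
    (sA : TensorProduct ℂ A D →+ TensorProduct ℂ A D)
    (sB : TensorProduct ℂ B D →+ TensorProduct ℂ B D)
    (hA : IsTensorStar sA) (hB : IsTensorStar sB)
    (f g : A →ₗ[ℂ] B) (k : A →ₗ[ℂ] B) (h : ∀ x y, star (f x) * g y = k (star x * y))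
    (v w : TensorProduct ℂ A D) :
    sB (TensorProduct.map f LinearMap.id v) * TensorProduct.map g LinearMap.id w
      = TensorProduct.map k LinearMap.id (sA v * w) := by
  induction v with
  | zero => simp
  | add v v' h1 h2 => simp only [map_add, add_mul, h1, h2]
  | tmul a d =>
    induction w with
    | zero => simp
    | add v v' h1 h2 => simp only [map_add, mul_add, h1, h2]
    | tmul a' d' =>
      rw [TensorProduct.map_tmul, TensorProduct.map_tmul, hB, hA,
        Algebra.TensorProduct.tmul_mul_tmul, Algebra.TensorProduct.tmul_mul_tmul,
        TensorProduct.map_tmul, h]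
      rfl

theorem tensor_star_mul2 {B D : Type} [NonUnitalCStarAlgebra B]
    [NonUnitalCStarAlgebra D]
    (sB : TensorProduct ℂ B D →+ TensorProduct ℂ B D) (hB : IsTensorStar sB)
    (f g : B →ₗ[ℂ] B) (h : ∀ x y, star (f x) * f y = star x * g y)
    (v w : TensorProduct ℂ B D) :
    sB (TensorProduct.map f LinearMap.id v) * TensorProduct.map f LinearMap.id w
      = sB v * TensorProduct.map g LinearMap.id w := by
  induction v with
  | zero => simp
  | add v v' h1 h2 => simp only [map_add, add_mul, h1, h2]
  | tmul a d =>
    induction w with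
    | zero => simp
    | add v v' h1 h2 => simp only [map_add, mul_add, h1, h2]
    | tmul a' d' =>
      rw [TensorProduct.map_tmul, TensorProduct.map_tmul, hB, hB,
        Algebra.TensorProduct.tmul_mul_tmul, TensorProduct.map_tmul,
        Algebra.TensorProduct.tmul_mul_tmul, h]
      rfl

theorem isom_of_unitary {B D : Type} [NonUnitalCStarAlgebra B] [NonUnitalCStarAlgebra D]
    (sB : TensorProduct ℂ B D →+ TensorProduct ℂ B D) (δ : TensorProduct ℂ B D → ℝ)
    (hB : IsTensorStar sB) (hδ : IsCStarSeminorm sB δ) (U : Unitization ℂ B)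
    (hU : star U * U = 1) (v : TensorProduct ℂ B D) :
    δ (TensorProduct.map (lmulU U) LinearMap.id v) = δ v := by
  have h := tensor_star_mul sB sB hB hB (lmulU U) (lmulU U) LinearMap.id
    (fun x y => star_lmulU_mul U hU x y) v v
  rw [TensorProduct.map_id, LinearMap.id_apply] at h
  have h2 := hδ.cstar (TensorProduct.map (lmulU U) LinearMap.id v)
  rw [h, hδ.cstar] at h2
  exact ((sq_eq_sq₀ (hδ.nonneg _) (hδ.nonneg _)).1 h2).symm

theorem exists_unitaries {B : Type} [NonUnitalCStarAlgebra B] (c : B) (hc : IsSelfAdjoint c)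
    (hn : ‖c‖ ≤ 1) : ∃ U V : Unitization ℂ B, star U * U = 1 ∧ star V * V = 1 ∧
      (c : Unitization ℂ B) = (2⁻¹ : ℂ) • (U + V) := by
  let _ : PartialOrder (Unitization ℂ B) := CStarAlgebra.spectralOrder _
  have : StarOrderedRing (Unitization ℂ B) := CStarAlgebra.spectralOrderedRing _
  have hc' : IsSelfAdjoint (c : Unitization ℂ B) := hc.inr ℂ
  have hn' : ‖(c : Unitization ℂ B)‖ ≤ 1 := by rwa [Unitization.norm_inr]
  have hU := hc'.self_add_I_smul_cfcSqrt_sub_sq_mem_unitary _ hn'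
  refine ⟨_, star (c + Complex.I • CFC.sqrt (1 - (c : Unitization ℂ B) ^ 2)),
    (Unitary.mem_iff.1 hU).1, ?_, ?_⟩
  · rw [star_star]; exact (Unitary.mem_iff.1 hU).2
  · have : IsSelfAdjoint (CFC.sqrt (1 - (c : Unitization ℂ B) ^ 2)) :=
      IsSelfAdjoint.of_nonneg (CFC.sqrt_nonneg _)
    rw [star_add, star_smul, this.star_eq, hc'.star_eq]
    simp only [Complex.star_def, Complex.conj_I, neg_smul]
    rw [show ∀ a b : Unitization ℂ B, a + b + (a + -b) = (2 : ℂ) • a by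
      intro a b; rw [two_smul]; abel]
    rw [smul_smul]; norm_num

theorem contr_selfAdjoint {B D : Type} [NonUnitalCStarAlgebra B] [NonUnitalCStarAlgebra D]
    (sB : TensorProduct ℂ B D →+ TensorProduct ℂ B D) (δ : TensorProduct ℂ B D → ℝ)
    (hB : IsTensorStar sB) (hδ : IsCStarSeminorm sB δ) (c : B) (hc : IsSelfAdjoint c)
    (hn : ‖c‖ ≤ 1) (v : TensorProduct ℂ B D) :
    δ (TensorProduct.map (LinearMap.mulLeft ℂ c) LinearMap.id v) ≤ δ v := by
  obtain ⟨U, V, hU, hV, h⟩ := exists_unitaries c hc hn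
  have e : LinearMap.mulLeft ℂ c = (2⁻¹ : ℂ) • (lmulU U + lmulU V) := by
    ext x
    apply Unitization.inr_injective (R := ℂ)
    simp only [LinearMap.mulLeft_apply, LinearMap.smul_apply, LinearMap.add_apply,
      Unitization.inr_mul, Unitization.inr_smul, Unitization.inr_add, inr_lmulU]
    rw [h, smul_mul_assoc, add_mul]
  rw [e, TensorProduct.map_smul_left, TensorProduct.map_add_left, LinearMap.smul_apply,
    LinearMap.add_apply, hδ.smul]
  have h1 := hδ.add_le (TensorProduct.map (lmulU U) LinearMap.id v)
    (TensorProduct.map (lmulU V) LinearMap.id v)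
  rw [isom_of_unitary sB δ hB hδ U hU, isom_of_unitary sB δ hB hδ V hV] at h1
  norm_num
  linarith

theorem contr_selfAdjoint' {B D : Type} [NonUnitalCStarAlgebra B] [NonUnitalCStarAlgebra D]
    (sB : TensorProduct ℂ B D →+ TensorProduct ℂ B D) (δ : TensorProduct ℂ B D → ℝ)
    (hB : IsTensorStar sB) (hδ : IsCStarSeminorm sB δ) (c : B) (hc : IsSelfAdjoint c)
    (v : TensorProduct ℂ B D) :
    δ (TensorProduct.map (LinearMap.mulLeft ℂ c) LinearMap.id v) ≤ ‖c‖ * δ v := by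
  by_cases h0 : c = 0
  · subst h0
    have := hδ.smul 0 0
    simp at this
    simp [this]
  have hp : 0 < ‖c‖ := norm_pos_iff.2 h0
  have hp' : (‖c‖ : ℂ) ≠ 0 := by exact_mod_cast hp.ne'
  have h1 := contr_selfAdjoint sB δ hB hδ (((‖c‖⁻¹ : ℝ) : ℂ) • c)
    (by rw [IsSelfAdjoint, star_smul, hc.star_eq]; simp)
    (by rw [norm_smul]; simp [hp.ne']) v
  have e : LinearMap.mulLeft ℂ (((‖c‖⁻¹ : ℝ) : ℂ) • c)
      = ((‖c‖⁻¹ : ℝ) : ℂ) • LinearMap.mulLeft ℂ c := by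
    ext x; simp [smul_mul_assoc]
  rw [e, TensorProduct.map_smul_left, LinearMap.smul_apply, hδ.smul, Complex.norm_real,
    norm_inv, norm_norm] at h1
  rwa [inv_mul_le_iff₀ hp] at h1

theorem contr {B D : Type} [NonUnitalCStarAlgebra B] [NonUnitalCStarAlgebra D]
    (sB : TensorProduct ℂ B D →+ TensorProduct ℂ B D) (δ : TensorProduct ℂ B D → ℝ)
    (hB : IsTensorStar sB) (hδ : IsCStarSeminorm sB δ) (c : B)
    (v : TensorProduct ℂ B D) :
    δ (TensorProduct.map (LinearMap.mulLeft ℂ c) LinearMap.id v) ≤ ‖c‖ * δ v := by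
  have hs : δ (sB v) ≤ δ v := by
    have h2 : sB (sB v) = v := by
      induction v with
      | zero => simp
      | add v v' h1 h2 =>
        rw [map_add, map_add, h1, h2]
      | tmul a d => rw [hB, hB, star_star, star_star]
    have h1 := hδ.cstar (sB v)
    rw [h2] at h1
    have h3 := hδ.mul_le v (sB v)
    rw [h1] at h3
    by_contra hlt
    push Not at hlt
    nlinarith [hδ.nonneg v]
  have e : sB (TensorProduct.map (LinearMap.mulLeft ℂ c) LinearMap.id v) *
      TensorProduct.map (LinearMap.mulLeft ℂ c) LinearMap.id v =
      sB v * TensorProduct.map (LinearMap.mulLeft ℂ (star c * c)) LinearMap.id v := by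
    exact tensor_star_mul2 sB hB _ _ (fun x y => by simp [mul_assoc]) v v
  have h1 := hδ.cstar (TensorProduct.map (LinearMap.mulLeft ℂ c) LinearMap.id v)
  rw [e] at h1
  have h2 := hδ.mul_le (sB v) (TensorProduct.map (LinearMap.mulLeft ℂ (star c * c)) LinearMap.id v)
  have h3 := contr_selfAdjoint' sB δ hB hδ (star c * c) (IsSelfAdjoint.star_mul_self c) v
  rw [CStarRing.norm_star_mul_self] at h3
  have hv := hδ.nonneg v
  refine (sq_le_sq₀ (hδ.nonneg _) (by positivity)).1 ?_
  have h4 := mul_le_mul hs h3 (hδ.nonneg _) hv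
  nlinarith

theorem statement12 {A B E : Type} [NonUnitalCStarAlgebra A] [NonUnitalCStarAlgebra B]
    [NonUnitalCStarAlgebra E]
    (ψ : A →⋆ₙₐ[ℂ] E) (j : B →⋆ₙₐ[ℂ] E) (hj : IsIdealEmbedding j)
    (b : B) (ρ : A →ₗ[ℂ] B) (hρ : ∀ x : A, j (ρ x) = ψ x * j b)
    (hnuc : IsNuclearMap ρ) :
    nucNorm ρ ≤ ‖b‖ := by
  have key : ∀ K : ℝ, 0 ≤ K → NuclearBound ρ K → NuclearBound ρ (√(‖b‖ * K)) := by
    intro K hK hN D _ sA sB γ δ hA hB hγ hδ x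
    have e := tensor_star_mul sA sB hA hB ρ ρ ((LinearMap.mulLeft ℂ (star b)).comp ρ)
      (fun x y => by
        apply hj.inj
        simp [hρ, map_star, mul_assoc]) x x
    have e2 : TensorProduct.map ((LinearMap.mulLeft ℂ (star b)).comp ρ)
        (LinearMap.id : D →ₗ[ℂ] D) (sA x * x) =
        TensorProduct.map (LinearMap.mulLeft ℂ (star b)) LinearMap.id
          (TensorProduct.map ρ LinearMap.id (sA x * x)) := by
      rw [← LinearMap.comp_apply, ← TensorProduct.map_comp, LinearMap.id_comp]
    have h1 := hδ.cstar (TensorProduct.map ρ LinearMap.id x)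
    rw [e, e2] at h1
    have h2 := contr sB δ hB hδ (star b) (TensorProduct.map ρ LinearMap.id (sA x * x))
    have h3 := hN D sA sB γ δ hA hB hγ hδ (sA x * x)
    rw [hγ.cstar] at h3
    rw [norm_star, h1] at h2
    have h4 := mul_le_mul_of_nonneg_left h3 (norm_nonneg b)
    refine (sq_le_sq₀ (hδ.nonneg _) (mul_nonneg (Real.sqrt_nonneg _) (hγ.nonneg _))).1 ?_
    rw [mul_pow, Real.sq_sqrt (by positivity)]
    linarith
  obtain ⟨K₀, hK₀, hN₀⟩ := hnuc
  have hbdd : BddBelow {K : ℝ | 0 ≤ K ∧ NuclearBound ρ K} := ⟨0, fun K hK => hK.1⟩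
  have hM0 : 0 ≤ nucNorm ρ := Real.sInf_nonneg fun K hK => hK.1
  have hle : ∀ K : ℝ, 0 ≤ K → NuclearBound ρ K → nucNorm ρ ^ 2 ≤ ‖b‖ * K := by
    intro K hK hN
    have : nucNorm ρ ≤ √(‖b‖ * K) := csInf_le hbdd ⟨Real.sqrt_nonneg _, key K hK hN⟩
    exact (Real.le_sqrt hM0 (by positivity)).1 this
  by_contra hlt
  push Not at hlt
  have hMpos : 0 < nucNorm ρ := lt_of_le_of_lt (norm_nonneg b) hlt
  rcases (norm_nonneg b).eq_or_lt with hb | hb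
  · have := hle K₀ hK₀ hN₀
    rw [← hb, zero_mul] at this
    nlinarith
  · have h5 : nucNorm ρ ^ 2 / ‖b‖ ≤ nucNorm ρ := by
      refine le_csInf ⟨K₀, hK₀, hN₀⟩ fun K hK => ?_
      rw [div_le_iff₀ hb]
      linarith [hle K hK.1 hK.2]
    rw [div_le_iff₀ hb] at h5
    nlinarith

end
end

section
/- Let ψ : A → E be a *-homomorphism of C*-algebras, let B be a closed two-sided ideal of E, and let X ⊆ B be a subset such that B is generated as a closed right ideal by X. If the linear map x ↦ ψ(x)b is nuclear for every b ∈ X, then ψ is weakly nuclear relative to B, i.e. x ↦ ψ(x)b is nuclear for every b ∈ B. -/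
/-!
Statement 13 (Lemma 5.2(7)): if `ψ : A → E` is a *-homomorphism, `B ⊴ E` a closed
two-sided ideal, and `X ⊆ B` a subset generating `B` as a closed right ideal, then
`ψ` is weakly nuclear relative to `B` (i.e. `x ↦ ψ(x) b` is nuclear for all `b ∈ B`)
provided `x ↦ ψ(x) b` is nuclear for all `b ∈ X`.

The ideal `B` is presented abstractly via an ideal embedding `j : B → E`, and the
linear map `x ↦ ψ(x) b` with values in `B` is any `ρ : A →ₗ B` with
`j (ρ x) = ψ x * j b`.
-/

noncomputable section
open scoped TensorProduct

section Helpers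

variable {A B D E : Type} [NonUnitalCStarAlgebra A] [NonUnitalCStarAlgebra B]
  [NonUnitalCStarAlgebra D] [NonUnitalCStarAlgebra E]

theorem h13_sinvol {s : TensorProduct ℂ B D →+ TensorProduct ℂ B D} (hs : IsTensorStar s)
    (x : TensorProduct ℂ B D) : s (s x) = x := by
  induction x using TensorProduct.induction_on with
  | zero => simp
  | tmul a d => rw [hs, hs, star_star, star_star]
  | add x y hx hy => rw [map_add, map_add, hx, hy]

theorem h13_zero {s : TensorProduct ℂ B D →+ TensorProduct ℂ B D}
    {δ : TensorProduct ℂ B D → ℝ} (hδ : IsCStarSeminorm s δ) : δ 0 = 0 := by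
  have := hδ.smul 0 0
  simpa using this

theorem h13_sle {s : TensorProduct ℂ B D →+ TensorProduct ℂ B D}
    {δ : TensorProduct ℂ B D → ℝ} (hδ : IsCStarSeminorm s δ)
    (x : TensorProduct ℂ B D) : δ x ≤ δ (s x) := by
  have h1 := hδ.cstar x
  have h2 := hδ.mul_le (s x) x
  have h3 := hδ.nonneg x
  have h4 := hδ.nonneg (s x)
  rcases h3.eq_or_lt with h | h
  · rw [← h]; exact h4
  · rw [h1, sq] at h2
    exact le_of_mul_le_mul_right h2 h

theorem h13_seq {s : TensorProduct ℂ B D →+ TensorProduct ℂ B D} (hs : IsTensorStar s)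
    {δ : TensorProduct ℂ B D → ℝ} (hδ : IsCStarSeminorm s δ)
    (x : TensorProduct ℂ B D) : δ (s x) = δ x := by
  refine le_antisymm ?_ (h13_sle hδ x)
  have := h13_sle hδ (s x)
  rwa [h13_sinvol hs] at this

theorem h13_bdd {U : Type} [CStarAlgebra U] {s : TensorProduct ℂ B D →+ TensorProduct ℂ B D}
    {δ : TensorProduct ℂ B D → ℝ} (hδ : IsCStarSeminorm s δ)
    (L : U →ₗ[ℂ] (TensorProduct ℂ B D →ₗ[ℂ] TensorProduct ℂ B D))
    (h1 : L 1 = LinearMap.id)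
    (h2 : ∀ u y, s (L u y) * L u y = s y * L (star u * u) y) (u : U)
    (y : TensorProduct ℂ B D) : δ (L u y) ≤ 2 * ‖u‖ * δ y := by
  have hun : ∀ v : unitary U, δ (L v y) = δ y := by
    intro v
    have h := hδ.cstar (L v y)
    rw [h2, Unitary.coe_star_mul_self, h1, LinearMap.id_apply, hδ.cstar] at h
    exact ((sq_eq_sq₀ (hδ.nonneg _) (hδ.nonneg _)).1 h).symm
  obtain ⟨v, c, hsum, hc⟩ := CStarAlgebra.exists_sum_four_unitary u
  have hterm : ∀ i, δ (L (c i • (v i : U)) y) ≤ ‖u‖ / 2 * δ y := by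
    intro i
    rw [map_smul, LinearMap.smul_apply, hδ.smul, hun]
    exact mul_le_mul_of_nonneg_right (hc i) (hδ.nonneg _)
  have hL : L u y = L (c 0 • (v 0 : U)) y + L (c 1 • (v 1 : U)) y + L (c 2 • (v 2 : U)) y +
      L (c 3 • (v 3 : U)) y := by
    have h := congrArg (fun w => L w y) hsum
    simpa only [Fin.sum_univ_four, map_add, LinearMap.add_apply] using h
  rw [hL]
  have e1 := hδ.add_le (L (c 0 • (v 0 : U)) y + L (c 1 • (v 1 : U)) y + L (c 2 • (v 2 : U)) y)
    (L (c 3 • (v 3 : U)) y)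
  have e2 := hδ.add_le (L (c 0 • (v 0 : U)) y + L (c 1 • (v 1 : U)) y) (L (c 2 • (v 2 : U)) y)
  have e3 := hδ.add_le (L (c 0 • (v 0 : U)) y) (L (c 1 • (v 1 : U)) y)
  have := hterm 0
  have := hterm 1
  have := hterm 2
  have := hterm 3
  linarith

def h13_L : Unitization ℂ B →ₗ[ℂ] (TensorProduct ℂ B D →ₗ[ℂ] TensorProduct ℂ B D) where
  toFun u := u.fst • LinearMap.id + LinearMap.rTensor D (LinearMap.mul ℂ B u.snd)
  map_add' u v := by
    simp only [Unitization.fst_add, Unitization.snd_add, map_add, LinearMap.rTensor_add, add_smul]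
    abel
  map_smul' c u := by
    simp only [Unitization.fst_smul, Unitization.snd_smul, map_smul, LinearMap.rTensor_smul,
      smul_add, smul_smul, smul_eq_mul, RingHom.id_apply]

def h13_R : Unitization ℂ D →ₗ[ℂ] (TensorProduct ℂ B D →ₗ[ℂ] TensorProduct ℂ B D) where
  toFun u := u.fst • LinearMap.id + LinearMap.lTensor B (LinearMap.mul ℂ D u.snd)
  map_add' u v := by
    simp only [Unitization.fst_add, Unitization.snd_add, map_add, LinearMap.lTensor_add, add_smul]
    abel
  map_smul' c u := by
    simp only [Unitization.fst_smul, Unitization.snd_smul, map_smul, LinearMap.lTensor_smul,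
      smul_add, smul_smul, smul_eq_mul, RingHom.id_apply]

theorem h13_L_tmul (u : Unitization ℂ B) (b : B) (d : D) :
    h13_L u (b ⊗ₜ[ℂ] d) = (u.fst • b + u.snd * b) ⊗ₜ[ℂ] d := by
  simp [h13_L, TensorProduct.add_tmul, TensorProduct.smul_tmul']

theorem h13_R_tmul (u : Unitization ℂ D) (b : B) (d : D) :
    h13_R u (b ⊗ₜ[ℂ] d) = b ⊗ₜ[ℂ] (u.fst • d + u.snd * d) := by
  simp [h13_R, TensorProduct.tmul_add]

theorem h13_L_star {s : TensorProduct ℂ B D →+ TensorProduct ℂ B D} (hs : IsTensorStar s)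
    (u : Unitization ℂ B) (y z : TensorProduct ℂ B D) :
    s (h13_L u y) * h13_L u z = s y * h13_L (star u * u) z := by
  induction y using TensorProduct.induction_on with
  | zero => simp
  | add x y hx hy => simp only [map_add, add_mul, hx, hy]
  | tmul b d =>
    induction z using TensorProduct.induction_on with
    | zero => simp
    | add x y hx hy => simp only [map_add, mul_add, hx, hy]
    | tmul b' d' =>
      simp only [h13_L_tmul, hs _ _, Algebra.TensorProduct.tmul_mul_tmul]
      congr 1
      simp only [Unitization.fst_mul, Unitization.snd_mul, Unitization.fst_star,
        Unitization.snd_star, star_add, star_mul, star_smul, add_mul, mul_add, smul_mul_assoc,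
        mul_smul_comm, mul_assoc, smul_smul, smul_add]
      rw [mul_comm (star u.fst) u.fst]
      abel

theorem h13_R_star {s : TensorProduct ℂ B D →+ TensorProduct ℂ B D} (hs : IsTensorStar s)
    (u : Unitization ℂ D) (y z : TensorProduct ℂ B D) :
    s (h13_R u y) * h13_R u z = s y * h13_R (star u * u) z := by
  induction y using TensorProduct.induction_on with
  | zero => simp
  | add x y hx hy => simp only [map_add, add_mul, hx, hy]
  | tmul b d =>
    induction z using TensorProduct.induction_on with
    | zero => simp
    | add x y hx hy => simp only [map_add, mul_add, hx, hy]
    | tmul b' d' =>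
      simp only [h13_R_tmul, hs _ _, Algebra.TensorProduct.tmul_mul_tmul]
      congr 1
      simp only [Unitization.fst_mul, Unitization.snd_mul, Unitization.fst_star,
        Unitization.snd_star, star_add, star_mul, star_smul, add_mul, mul_add, smul_mul_assoc,
        mul_smul_comm, mul_assoc, smul_smul, smul_add]
      rw [mul_comm (star u.fst) u.fst]
      abel

theorem h13_L_le {s : TensorProduct ℂ B D →+ TensorProduct ℂ B D} (hs : IsTensorStar s)
    {δ : TensorProduct ℂ B D → ℝ} (hδ : IsCStarSeminorm s δ) (c : B)
    (y : TensorProduct ℂ B D) :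
    δ (LinearMap.rTensor D (LinearMap.mul ℂ B c) y) ≤ 2 * ‖c‖ * δ y := by
  have h := h13_bdd hδ (h13_L (B := B) (D := D)) (by ext; simp [h13_L])
    (fun u y => h13_L_star hs u y y) (c : Unitization ℂ B) y
  rw [Unitization.norm_inr] at h
  simpa [h13_L] using h

theorem h13_R_le {s : TensorProduct ℂ B D →+ TensorProduct ℂ B D} (hs : IsTensorStar s)
    {δ : TensorProduct ℂ B D → ℝ} (hδ : IsCStarSeminorm s δ) (c : D)
    (y : TensorProduct ℂ B D) :
    δ (LinearMap.lTensor B (LinearMap.mul ℂ D c) y) ≤ 2 * ‖c‖ * δ y := by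
  have h := h13_bdd hδ (h13_R (B := B) (D := D)) (by ext; simp [h13_R])
    (fun u y => h13_R_star hs u y y) (c : Unitization ℂ D) y
  rw [Unitization.norm_inr] at h
  simpa [h13_R] using h

theorem h13_tmul_le {s : TensorProduct ℂ B D →+ TensorProduct ℂ B D} (hs : IsTensorStar s)
    {δ : TensorProduct ℂ B D → ℝ} (hδ : IsCStarSeminorm s δ) (b : B) (d : D) :
    δ (b ⊗ₜ[ℂ] d) ≤ 4 * ‖b‖ * ‖d‖ := by
  have h0 := hδ.nonneg (b ⊗ₜ[ℂ] d)
  rcases h0.eq_or_lt with h | h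
  · rw [← h]; positivity
  have h1 := hδ.cstar (b ⊗ₜ[ℂ] d)
  have h2 := h13_L_le hs hδ (star b) (b ⊗ₜ[ℂ] (star d * d))
  have h3 := h13_R_le hs hδ (star d) (b ⊗ₜ[ℂ] d)
  rw [hs, Algebra.TensorProduct.tmul_mul_tmul] at h1
  simp only [LinearMap.rTensor_tmul, LinearMap.lTensor_tmul, LinearMap.mul_apply', norm_star]
    at h2 h3
  rw [h1] at h2
  have h4 := mul_le_mul_of_nonneg_left h3 (by positivity : 0 ≤ 2 * ‖b‖)
  refine le_of_mul_le_mul_right ?_ h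
  nlinarith

/-- The linear map `b, x ↦ ψ(x) b`. -/
theorem h13_exR (ψ : A →⋆ₙₐ[ℂ] E) (j : B →⋆ₙₐ[ℂ] E) (hj : IsIdealEmbedding j) :
    ∃ R : B →ₗ[ℂ] A →ₗ[ℂ] B, ∀ b x, j (R b x) = ψ x * j b := by
  choose f hf using hj.mul_mem_left
  refine ⟨LinearMap.mk₂ ℂ (fun b x => f (ψ x) b) ?_ ?_ ?_ ?_, fun b x => hf _ _⟩
  · intro b b' x; apply hj.inj; simp [hf, mul_add]
  · intro c b x; apply hj.inj; simp [hf, mul_smul_comm]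
  · intro b x x'; apply hj.inj; simp [hf, add_mul]
  · intro c b x; apply hj.inj; simp [hf, smul_mul_assoc]

theorem h13_bound (ψ : A →⋆ₙₐ[ℂ] E) (j : B →⋆ₙₐ[ℂ] E) (hj : IsIdealEmbedding j)
    (b : B) (ρ : A →ₗ[ℂ] B) (hρ : ∀ x, j (ρ x) = ψ x * j b) (h : IsNuclearMap ρ) :
    NuclearBound ρ (2 * ‖b‖) := by
  have step : ∀ K, 0 ≤ K → NuclearBound ρ K → NuclearBound ρ (Real.sqrt (2 * ‖b‖ * K)) := by
    intro K hK hb D _ sA sB γ δ hsA hsB hγ hδ x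
    have key : ∀ x z, sB (TensorProduct.map ρ LinearMap.id x) *
        TensorProduct.map ρ (LinearMap.id : D →ₗ[ℂ] D) z =
        LinearMap.rTensor D (LinearMap.mul ℂ B (star b))
          (TensorProduct.map ρ LinearMap.id (sA x * z)) := by
      intro x z
      induction x using TensorProduct.induction_on with
      | zero => simp
      | add x y hx hy => simp only [map_add, add_mul, hx, hy]
      | tmul a d =>
        induction z using TensorProduct.induction_on with
        | zero => simp
        | add x y hx hy => simp only [map_add, mul_add, hx, hy]
        | tmul a' d' =>
          simp only [TensorProduct.map_tmul, hsA _ _, hsB _ _,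
            Algebra.TensorProduct.tmul_mul_tmul, LinearMap.rTensor_tmul, LinearMap.mul_apply',
            LinearMap.id_apply]
          congr 1
          apply hj.inj
          simp only [map_mul, map_star, hρ, star_mul, mul_assoc]
    have e1 := hδ.cstar (TensorProduct.map ρ LinearMap.id x)
    rw [key] at e1
    have e2 := h13_L_le hsB hδ (star b) (TensorProduct.map ρ LinearMap.id (sA x * x))
    rw [e1, norm_star] at e2
    have e3 := hb D sA sB γ δ hsA hsB hγ hδ (sA x * x)
    rw [hγ.cstar] at e3
    have e4 := mul_le_mul_of_nonneg_left e3 (by positivity : 0 ≤ 2 * ‖b‖)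
    have g0 := hγ.nonneg x
    refine (sq_le_sq₀ (hδ.nonneg _) (by positivity)).1 ?_
    rw [mul_pow, Real.sq_sqrt (by positivity)]
    linarith
  have hbdd : BddBelow {K : ℝ | 0 ≤ K ∧ NuclearBound ρ K} := ⟨0, fun K hK => hK.1⟩
  have hne : {K : ℝ | 0 ≤ K ∧ NuclearBound ρ K}.Nonempty := h
  have hN0 : 0 ≤ nucNorm ρ := le_csInf hne fun K hK => hK.1
  have hN : NuclearBound ρ (nucNorm ρ) := by
    intro D _ sA sB γ δ hsA hsB hγ hδ x
    rcases (hγ.nonneg x).eq_or_lt with h0 | h0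
    · obtain ⟨K, hK, hb⟩ := h
      have := hb D sA sB γ δ hsA hsB hγ hδ x
      rw [← h0] at this ⊢
      simpa using this
    · rw [← div_le_iff₀ h0]
      refine le_csInf hne fun K hK => ?_
      rw [div_le_iff₀ h0]
      exact hK.2 D sA sB γ δ hsA hsB hγ hδ x
  have hle : nucNorm ρ ≤ Real.sqrt (2 * ‖b‖ * nucNorm ρ) :=
    csInf_le hbdd ⟨Real.sqrt_nonneg _, step _ hN0 hN⟩
  have hfin : nucNorm ρ ≤ 2 * ‖b‖ := by
    rcases hN0.eq_or_lt with h0 | h0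
    · rw [← h0]; positivity
    · have := (Real.le_sqrt hN0 (by positivity)).1 hle
      rw [sq] at this
      exact le_of_mul_le_mul_right this h0
  intro D _ sA sB γ δ hsA hsB hγ hδ x
  exact (hN D sA sB γ δ hsA hsB hγ hδ x).trans
    (mul_le_mul_of_nonneg_right hfin (hγ.nonneg x))

theorem h13_lip (ψ : A →⋆ₙₐ[ℂ] E) (j : B →⋆ₙₐ[ℂ] E) (hj : IsIdealEmbedding j)
    (R : B →ₗ[ℂ] A →ₗ[ℂ] B) (hR : ∀ b x, j (R b x) = ψ x * j b)
    {s : TensorProduct ℂ B D →+ TensorProduct ℂ B D} (hs : IsTensorStar s)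
    {δ : TensorProduct ℂ B D → ℝ} (hδ : IsCStarSeminorm s δ) (x : TensorProduct ℂ A D) :
    ∃ C : ℝ, ∀ c, δ (TensorProduct.map (R c) LinearMap.id x) ≤ C * ‖c‖ := by
  induction x using TensorProduct.induction_on with
  | zero => exact ⟨0, fun c => by simp [h13_zero hδ]⟩
  | add x y hx hy =>
    obtain ⟨C, hC⟩ := hx
    obtain ⟨C', hC'⟩ := hy
    refine ⟨C + C', fun c => ?_⟩
    rw [map_add, add_mul]
    exact (hδ.add_le _ _).trans (add_le_add (hC c) (hC' c))
  | tmul a d =>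
    refine ⟨4 * ‖a‖ * ‖d‖, fun c => ?_⟩
    rw [TensorProduct.map_tmul, LinearMap.id_apply]
    refine (h13_tmul_le hs hδ _ _).trans ?_
    have h1 : ‖R c a‖ ≤ ‖a‖ * ‖c‖ := by
      rw [← NonUnitalStarAlgHom.norm_map j hj.inj (R c a), hR]
      refine (norm_mul_le _ _).trans ?_
      rw [NonUnitalStarAlgHom.norm_map j hj.inj]
      exact mul_le_mul_of_nonneg_right (NonUnitalStarAlgHom.norm_apply_le ψ a) (norm_nonneg _)
    have := mul_le_mul_of_nonneg_right h1 (norm_nonneg d)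
    nlinarith

end Helpers

theorem statement13 {A B E : Type} [NonUnitalCStarAlgebra A] [NonUnitalCStarAlgebra B]
    [NonUnitalCStarAlgebra E]
    (ψ : A →⋆ₙₐ[ℂ] E) (j : B →⋆ₙₐ[ℂ] E) (hj : IsIdealEmbedding j)
    (X : Set B)
    -- `B` is generated as a closed right ideal by `X`: every closed subspace of `B`
    -- containing `X` and stable under right multiplication is all of `B`
    (hX : ∀ S : Submodule ℂ B, IsClosed (S : Set B) →
      (∀ s ∈ S, ∀ c : B, s * c ∈ S) → X ⊆ (S : Set B) → ∀ b : B, b ∈ S)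
    -- `x ↦ ψ(x) b` is nuclear for every `b ∈ X`
    (hnuc : ∀ b ∈ X, ∀ ρ : A →ₗ[ℂ] B, (∀ x : A, j (ρ x) = ψ x * j b) → IsNuclearMap ρ) :
    -- then `ψ` is weakly nuclear relative to `B`
    ∀ b : B, ∀ ρ : A →ₗ[ℂ] B, (∀ x : A, j (ρ x) = ψ x * j b) → IsNuclearMap ρ := by
  obtain ⟨R, hR⟩ := h13_exR ψ j hj
  have huniq : ∀ b (ρ : A →ₗ[ℂ] B), (∀ x : A, j (ρ x) = ψ x * j b) → ρ = R b := by
    intro b ρ hρ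
    ext x
    apply hj.inj
    rw [hρ, hR]
  have hiff : ∀ b, IsNuclearMap (R b) ↔ NuclearBound (R b) (2 * ‖b‖) := fun b =>
    ⟨h13_bound ψ j hj b (R b) (hR b), fun h => ⟨_, by positivity, h⟩⟩
  let S : Submodule ℂ B :=
    { carrier := {b | IsNuclearMap (R b)}
      zero_mem' := by
        refine ⟨0, le_rfl, ?_⟩
        intro D _ sA sB γ δ hsA hsB hγ hδ x
        simp [h13_zero hδ]
      add_mem' := by
        rintro b c ⟨K, hK, hb⟩ ⟨K', hK', hc⟩
        refine ⟨K + K', by positivity, ?_⟩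
        intro D _ sA sB γ δ hsA hsB hγ hδ x
        rw [map_add, TensorProduct.map_add_left, add_mul]
        exact (hδ.add_le _ _).trans (add_le_add (hb D sA sB γ δ hsA hsB hγ hδ x)
          (hc D sA sB γ δ hsA hsB hγ hδ x))
      smul_mem' := by
        rintro c b ⟨K, hK, hb⟩
        refine ⟨‖c‖ * K, by positivity, ?_⟩
        intro D _ sA sB γ δ hsA hsB hγ hδ x
        rw [map_smul, TensorProduct.map_smul_left, LinearMap.smul_apply, hδ.smul, mul_assoc]
        exact mul_le_mul_of_nonneg_left (hb D sA sB γ δ hsA hsB hγ hδ x) (norm_nonneg _) }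
  have hS : ∀ b, b ∈ S ↔ IsNuclearMap (R b) := fun b => Iff.rfl
  intro b ρ hρ
  rw [huniq b ρ hρ, ← hS]
  refine hX S ?_ ?_ ?_ b
  · rw [← isSeqClosed_iff_isClosed]
    intro u b hu hlim
    change IsNuclearMap (R b)
    rw [hiff]
    intro D _ sA sB γ δ hsA hsB hγ hδ x
    obtain ⟨C, hC⟩ := h13_lip ψ j hj R hR hsB hδ x
    have hn : ∀ n, δ (TensorProduct.map (R b) LinearMap.id x) ≤
        2 * ‖u n‖ * γ x + C * ‖b - u n‖ := by
      intro n
      have h1 := (hiff (u n)).1 (hu n) D sA sB γ δ hsA hsB hγ hδ x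
      have h2 := hC (b - u n)
      have h3 := hδ.add_le (TensorProduct.map (R (u n)) LinearMap.id x)
        (TensorProduct.map (R (b - u n)) LinearMap.id x)
      rw [← LinearMap.add_apply, ← TensorProduct.map_add_left, ← map_add,
        add_sub_cancel] at h3
      linarith
    have ht : Filter.Tendsto (fun n => 2 * ‖u n‖ * γ x + C * ‖b - u n‖) Filter.atTop
        (nhds (2 * ‖b‖ * γ x + C * ‖b - b‖)) :=
      ((hlim.norm.const_mul 2).mul_const _).add ((hlim.const_sub b).norm.const_mul C)
    have := ge_of_tendsto' ht hn
    simpa using this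
  · intro b hb c
    obtain ⟨K, hK, hb⟩ := hb
    refine ⟨2 * ‖c‖ * K, by positivity, ?_⟩
    intro D _ sA sB γ δ hsA hsB hγ hδ x
    have key : sB (TensorProduct.map (R (b * c)) (LinearMap.id : D →ₗ[ℂ] D) x) =
        LinearMap.rTensor D (LinearMap.mul ℂ B (star c))
          (sB (TensorProduct.map (R b) LinearMap.id x)) := by
      induction x using TensorProduct.induction_on with
      | zero => simp
      | add x y hx hy => simp only [map_add, hx, hy]
      | tmul a d =>
        simp only [TensorProduct.map_tmul, hsB _ _, LinearMap.rTensor_tmul,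
          LinearMap.mul_apply', LinearMap.id_apply]
        congr 1
        apply hj.inj
        simp only [map_mul, map_star, hR, star_mul, mul_assoc]
    rw [← h13_seq hsB hδ, key]
    refine (h13_L_le hsB hδ _ _).trans ?_
    rw [h13_seq hsB hδ, norm_star, mul_assoc (2 * ‖c‖)]
    exact mul_le_mul_of_nonneg_left (hb D sA sB γ δ hsA hsB hγ hδ x) (by positivity)
  · intro b hb
    exact hnuc b hb (R b) (hR b)

end
end
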